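/- Let h ∈ ℤ⁺. There exists a multiplicative complement (A_1,…,A_h) of order h such that lim_{x→∞} max{A_1(x),…,A_h(x)} · (log x)^{1-1/h} / x = 1/Γ(1/h). -/

import Mathlib

open Filter Real

/-- Counting function: `A(x) = |A ∩ {1,…,⌊x⌋}|`. -/
noncomputable def cntF (A : Set ℕ) (x : ℝ) : ℕ := (A ∩ Set.Icc 1 ⌊x⌋₊).ncard

/-- Common multiplicative representation function. -/
noncomputable def mulRepFam (h : ℕ) (A : Fin h → Set ℕ) (n : ℕ) : ℕ :=
  {f : Fin h → ℕ | (∀ i, f i ∈ A i) ∧ ∏ i, f i = n}.ncard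

/-- `(A_1,…,A_h)` is a multiplicative complement of order `h`. -/
def IsMC (h : ℕ) (A : Fin h → Set ℕ) : Prop := ∀ n : ℕ, 1 ≤ n → 1 ≤ mulRepFam h A n

open MeasureTheory Set Topology in
theorem integral_triangle_mul_cexp (v : ℝ) :
    ∫ t in (-1 : ℝ)..1, ((1 - |t| : ℝ) : ℂ) * Complex.exp (Complex.I * t * v) =
      ((sinc (v / 2) ^ 2 : ℝ) : ℂ) := by
  have hInt : ∀ a b : ℝ, IntervalIntegrable
      (fun t : ℝ => ((1 - |t| : ℝ) : ℂ) * Complex.exp (Complex.I * t * v)) volume a b := by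
    intro a b
    apply Continuous.intervalIntegrable
    fun_prop
  rw [← intervalIntegral.integral_add_adjacent_intervals (hInt (-1) 0) (hInt 0 1)]
  have e1 : ∫ t in (-1 : ℝ)..0, ((1 - |t| : ℝ) : ℂ) * Complex.exp (Complex.I * t * v) =
      ∫ t in (-1 : ℝ)..0, (1 + t : ℂ) * Complex.exp (Complex.I * t * v) := by
    apply intervalIntegral.integral_congr
    intro t ht
    rw [uIcc_of_le (by norm_num)] at ht
    simp only [abs_of_nonpos ht.2]
    push_cast; ring
  have e2 : ∫ t in (0 : ℝ)..1, ((1 - |t| : ℝ) : ℂ) * Complex.exp (Complex.I * t * v) =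
      ∫ t in (0 : ℝ)..1, (1 - t : ℂ) * Complex.exp (Complex.I * t * v) := by
    apply intervalIntegral.integral_congr
    intro t ht
    rw [uIcc_of_le (by norm_num)] at ht
    simp only [abs_of_nonneg ht.1]
    push_cast; ring
  rw [e1, e2]
  rcases eq_or_ne v 0 with rfl | hv
  · have d1 : ∀ t : ℝ, HasDerivAt (fun t : ℝ => (t + t ^ 2 / 2 : ℂ)) (1 + t : ℂ) t := by
      intro t
      have h := (Complex.ofRealCLM.hasDerivAt (x := t))
      simp only [Complex.ofRealCLM_apply, Complex.ofReal_one] at h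
      refine (h.add ((h.pow 2).div_const 2)).congr_deriv ?_
      simp
    have d2 : ∀ t : ℝ, HasDerivAt (fun t : ℝ => (t - t ^ 2 / 2 : ℂ)) (1 - t : ℂ) t := by
      intro t
      have h := (Complex.ofRealCLM.hasDerivAt (x := t))
      simp only [Complex.ofRealCLM_apply, Complex.ofReal_one] at h
      refine (h.sub ((h.pow 2).div_const 2)).congr_deriv ?_
      simp
    simp only [Complex.ofReal_zero, mul_zero, Complex.exp_zero, mul_one]
    rw [intervalIntegral.integral_eq_sub_of_hasDerivAt (fun t _ => d1 t)
        (Continuous.intervalIntegrable (by fun_prop) _ _),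
      intervalIntegral.integral_eq_sub_of_hasDerivAt (fun t _ => d2 t)
        (Continuous.intervalIntegrable (by fun_prop) _ _)]
    simp
    norm_num
  · have hc : Complex.I * v ≠ 0 := mul_ne_zero Complex.I_ne_zero (by exact_mod_cast hv)
    set c := Complex.I * v with hcdef
    have hE : ∀ t : ℝ, Complex.exp (Complex.I * t * v) = Complex.exp (c * t) := by
      intro t; congr 1; rw [hcdef]; ring
    simp only [hE]
    have dE : ∀ t : ℝ,
        HasDerivAt (fun t : ℝ => Complex.exp (c * t)) (Complex.exp (c * t) * c) t := by
      intro t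
      have h := (Complex.ofRealCLM.hasDerivAt (x := t))
      simp only [Complex.ofRealCLM_apply, Complex.ofReal_one] at h
      simpa using (h.const_mul c).cexp
    have d1 : ∀ t : ℝ, HasDerivAt (fun t : ℝ => ((1 + t) * Complex.exp (c * t) / c -
        Complex.exp (c * t) / c ^ 2 : ℂ)) ((1 + t) * Complex.exp (c * t)) t := by
      intro t
      have h := (Complex.ofRealCLM.hasDerivAt (x := t))
      simp only [Complex.ofRealCLM_apply, Complex.ofReal_one] at h
      refine ((((h.const_add 1).mul (dE t)).div_const c).sub
        ((dE t).div_const (c ^ 2))).congr_deriv ?_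
      rw [Complex.ofRealCLM_apply]
      field_simp
      ring
    have d2 : ∀ t : ℝ, HasDerivAt (fun t : ℝ => ((1 - t) * Complex.exp (c * t) / c +
        Complex.exp (c * t) / c ^ 2 : ℂ)) ((1 - t) * Complex.exp (c * t)) t := by
      intro t
      have h := (Complex.ofRealCLM.hasDerivAt (x := t))
      simp only [Complex.ofRealCLM_apply, Complex.ofReal_one] at h
      refine ((((h.const_sub 1).mul (dE t)).div_const c).add
        ((dE t).div_const (c ^ 2))).congr_deriv ?_
      rw [Complex.ofRealCLM_apply]
      field_simp
      ring
    rw [intervalIntegral.integral_eq_sub_of_hasDerivAt (fun t _ => d1 t)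
        (Continuous.intervalIntegrable (by fun_prop) _ _),
      intervalIntegral.integral_eq_sub_of_hasDerivAt (fun t _ => d2 t)
        (Continuous.intervalIntegrable (by fun_prop) _ _)]
    have hv2 : v / 2 ≠ 0 := by positivity
    have hs : sinc (v / 2) ^ 2 = (2 - 2 * Real.cos v) / v ^ 2 := by
      rw [sinc_of_ne_zero hv2]
      have : Real.cos v = 1 - 2 * Real.sin (v / 2) ^ 2 := by
        have := Real.cos_two_mul (v / 2)
        rw [Real.cos_sq'] at this
        rw [show v = 2 * (v / 2) by ring, this]; ring_nf
      rw [this]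
      field_simp
      ring
    rw [hs]
    push_cast
    have hcos : (Complex.cos v) = (Complex.exp c + Complex.exp (-c)) / 2 := by
      rw [Complex.cos, hcdef]; ring_nf
    rw [hcos]
    have hcc : c ^ 2 = - (v : ℂ) ^ 2 := by rw [hcdef, mul_pow, Complex.I_sq]; ring
    rw [show (v : ℂ) ^ 2 = - c ^ 2 by rw [hcc]; ring]
    simp only [mul_neg, mul_one, mul_zero, Complex.exp_zero]
    field_simp
    ring

theorem integrable_sinc_sq : MeasureTheory.Integrable (fun v : ℝ => sinc (v / 2) ^ 2) := by
  have h := (integrable_inv_one_add_sq).const_mul 5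
  refine h.mono' (by
    have : Continuous (fun v : ℝ => sinc (v / 2) ^ 2) := by
      have := continuous_sinc
      fun_prop
    exact this.aestronglyMeasurable) (Eventually.of_forall fun v => ?_)
  rw [Real.norm_of_nonneg (by positivity), ← div_eq_mul_inv, le_div_iff₀ (by positivity)]
  have h1 : sinc (v / 2) ^ 2 ≤ 1 := by
    have := abs_sinc_le_one (v / 2)
    rw [← sq_abs]
    nlinarith [abs_nonneg (sinc (v / 2))]
  have h2 : sinc (v / 2) ^ 2 * v ^ 2 ≤ 4 := by
    rcases eq_or_ne v 0 with rfl | hv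
    · simp
    · rw [sinc_of_ne_zero (by positivity)]
      have := Real.sin_sq_le_one (v / 2)
      field_simp
      linarith
  linarith

theorem integral_sinc_sq_pos : 0 < ∫ v : ℝ, sinc (v / 2) ^ 2 := by
  have hc : Continuous (fun v : ℝ => sinc (v / 2) ^ 2) := by
    have := continuous_sinc
    fun_prop
  rw [MeasureTheory.integral_pos_iff_support_of_nonneg (fun v => by positivity) integrable_sinc_sq]
  refine (hc.isOpen_support).measure_pos _ ⟨0, by simp⟩

open MeasureTheory Set Topology in
theorem integral_mul_sinc_sq_of_laplace {g : ℝ → ℝ} {M : ℝ} (hgm : Measurable g)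
    (hgM : ∀ u, |g u| ≤ M) {G : ℂ → ℂ}
    (hL : ∀ w : ℂ, 0 < w.re → ∫ u in Ioi (0 : ℝ), (g u : ℂ) * Complex.exp (-w * u) = G w)
    (l y : ℝ) {s : ℝ} (hs : 0 < s) :
    ∫ u in Ioi (0 : ℝ), (g u : ℂ) * Complex.exp (-s * u) * ((sinc (l * (y - u) / 2) ^ 2 : ℝ) : ℂ) =
      ∫ t in (-1 : ℝ)..1, ((1 - |t| : ℝ) : ℂ) * Complex.exp (Complex.I * t * (l * y)) *
        G (s + Complex.I * (l * t)) := by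
  have hM : 0 ≤ M := (abs_nonneg _).trans (hgM 0)
  have step1 : ∀ t : ℝ, ((1 - |t| : ℝ) : ℂ) * Complex.exp (Complex.I * t * (l * y)) *
        G (s + Complex.I * (l * t)) = ∫ u in Ioi (0 : ℝ),
        (g u : ℂ) * Complex.exp (-s * u) *
          (((1 - |t| : ℝ) : ℂ) * Complex.exp (Complex.I * t * (l * (y - u) : ℝ))) := by
    intro t
    rw [← hL _ (by simp [hs]), ← integral_const_mul]
    refine integral_congr_ae (Eventually.of_forall fun u => ?_)
    simp only
    have : Complex.exp (-s * u) * Complex.exp (Complex.I * t * (l * (y - u) : ℝ)) =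
        Complex.exp (Complex.I * t * (l * y)) * Complex.exp (-(s + Complex.I * (l * t)) * u) := by
      rw [← Complex.exp_add, ← Complex.exp_add]
      congr 1
      push_cast
      ring
    linear_combination (-(g u : ℂ) * ((1 - |t| : ℝ) : ℂ)) * this
  simp_rw [step1, ← integral_triangle_mul_cexp]
  simp_rw [intervalIntegral.integral_of_le (show (-1 : ℝ) ≤ 1 by norm_num), ← integral_const_mul]
  apply integral_integral_swap
  have hb : Integrable (fun p : ℝ × ℝ => (M * Real.exp (-s * p.1)) * (1 : ℝ))
      ((volume.restrict (Ioi 0)).prod (volume.restrict (Ioc (-1) 1))) := by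
    refine Integrable.mul_prod (f := fun u => M * Real.exp (-s * u)) (g := fun _ => (1 : ℝ)) ?_ ?_
    · exact (integrableOn_exp_mul_Ioi (by linarith) 0).const_mul M
    · exact integrable_const _
  refine hb.mono' ?_ ?_
  · apply Measurable.aestronglyMeasurable
    simp only [Function.uncurry_def]
    fun_prop
  · have : ∀ᵐ p : ℝ × ℝ ∂((volume.restrict (Ioi 0)).prod (volume.restrict (Ioc (-1) 1))),
        p ∈ Ioi (0 : ℝ) ×ˢ Ioc (-1 : ℝ) 1 := by
      rw [Measure.prod_restrict]
      exact ae_restrict_mem (measurableSet_Ioi.prod measurableSet_Ioc)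
    filter_upwards [this] with p hp
    simp only [Function.uncurry_def, norm_mul, Complex.norm_real, Complex.norm_exp]
    have h1 : (-(s : ℂ) * p.1).re = - s * p.1 := by simp
    have h2 : (Complex.I * p.2 * (l * (y - p.1) : ℝ)).re = 0 := by simp
    rw [h1, h2, Real.exp_zero, mul_one]
    have h3 : ‖1 - |p.2|‖ ≤ 1 := by
      have := abs_le.mpr ⟨hp.2.1.le, hp.2.2⟩
      rw [Real.norm_of_nonneg (by linarith)]
      linarith [abs_nonneg p.2]
    exact mul_le_mul (mul_le_mul_of_nonneg_right (hgM _) (Real.exp_pos _).le) h3 (norm_nonneg _)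
      (by positivity)

theorem integrable_sinc_sq_comp {l : ℝ} (hl : 0 < l) (y : ℝ) :
    MeasureTheory.Integrable (fun u : ℝ => sinc (l * (y - u) / 2) ^ 2) :=
  (integrable_sinc_sq.comp_mul_left' hl.ne').comp_sub_left y

open MeasureTheory Set Topology in
theorem integral_mul_sinc_sq_boundary {g : ℝ → ℝ} {M : ℝ} (hgm : Measurable g)
    (hgM : ∀ u, |g u| ≤ M) {G : ℂ → ℂ} (hG : Continuous G)
    (hL : ∀ w : ℂ, 0 < w.re → ∫ u in Ioi (0 : ℝ), (g u : ℂ) * Complex.exp (-w * u) = G w)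
    {l : ℝ} (hl : 0 < l) (y : ℝ) :
    ∫ u in Ioi (0 : ℝ), (g u : ℂ) * ((sinc (l * (y - u) / 2) ^ 2 : ℝ) : ℂ) =
      ∫ t in (-1 : ℝ)..1, ((1 - |t| : ℝ) : ℂ) * Complex.exp (Complex.I * t * (l * y)) *
        G (Complex.I * (l * t)) := by
  have hR : Tendsto (fun s : ℝ => ∫ t in (-1 : ℝ)..1, ((1 - |t| : ℝ) : ℂ) *
      Complex.exp (Complex.I * t * (l * y)) * G (s + Complex.I * (l * t))) (𝓝[>] 0)
      (𝓝 (∫ t in (-1 : ℝ)..1, ((1 - |t| : ℝ) : ℂ) * Complex.exp (Complex.I * t * (l * y)) *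
        G (Complex.I * (l * t)))) := by
    have hc : Continuous (fun s : ℝ => ∫ t in (-1 : ℝ)..1, ((1 - |t| : ℝ) : ℂ) *
      Complex.exp (Complex.I * t * (l * y)) * G (s + Complex.I * (l * t))) := by
      apply intervalIntegral.continuous_parametric_intervalIntegral_of_continuous'
      simp only [Function.uncurry_def]
      fun_prop
    have := (hc.tendsto 0).mono_left (nhdsWithin_le_nhds (s := Ioi 0))
    simpa using this
  have hLs : Tendsto (fun s : ℝ => ∫ u in Ioi (0 : ℝ), (g u : ℂ) * Complex.exp (-s * u) *
      ((sinc (l * (y - u) / 2) ^ 2 : ℝ) : ℂ)) (𝓝[>] 0)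
      (𝓝 (∫ u in Ioi (0 : ℝ), (g u : ℂ) * ((sinc (l * (y - u) / 2) ^ 2 : ℝ) : ℂ))) := by
    have hsm : Measurable (fun u : ℝ => sinc (l * (y - u) / 2)) :=
      (continuous_sinc.comp (by fun_prop)).measurable
    refine tendsto_integral_filter_of_dominated_convergence
      (fun u => M * sinc (l * (y - u) / 2) ^ 2) ?_ ?_ ?_ ?_
    · refine Eventually.of_forall fun s => Measurable.aestronglyMeasurable ?_
      fun_prop
    · filter_upwards [self_mem_nhdsWithin] with s hs
      filter_upwards [ae_restrict_mem measurableSet_Ioi] with u hu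
      have hs' : 0 < s := hs
      have hu' : 0 < u := hu
      simp only [norm_mul, Complex.norm_real, Complex.norm_exp]
      have h1 : (-(s : ℂ) * u).re = - s * u := by simp
      rw [h1]
      have h2 : Real.exp (-s * u) ≤ 1 := Real.exp_le_one_iff.mpr (by nlinarith)
      rw [Real.norm_of_nonneg (sq_nonneg (sinc _))]
      refine mul_le_mul_of_nonneg_right ?_ (sq_nonneg _)
      calc ‖g u‖ * Real.exp (-s * u) ≤ ‖g u‖ * 1 := by gcongr
        _ ≤ M := by rw [mul_one]; exact hgM u
    · exact ((integrable_sinc_sq_comp hl y).const_mul M).integrableOn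
    · refine Eventually.of_forall fun u => ?_
      have hc : Continuous (fun s : ℝ => (g u : ℂ) * Complex.exp (-s * u) *
        ((sinc (l * (y - u) / 2) ^ 2 : ℝ) : ℂ)) := by fun_prop
      have := (hc.tendsto 0).mono_left (nhdsWithin_le_nhds (s := Ioi 0))
      simpa using this
  refine tendsto_nhds_unique hLs (hR.congr' ?_)
  filter_upwards [self_mem_nhdsWithin] with s hs
  exact (integral_mul_sinc_sq_of_laplace hgm hgM hL l y hs).symm

open MeasureTheory Set Topology in
theorem tendsto_integral_mul_sinc_sq {g : ℝ → ℝ} {M : ℝ} (hgm : Measurable g)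
    (hgM : ∀ u, |g u| ≤ M) {G : ℂ → ℂ} (hG : Continuous G)
    (hL : ∀ w : ℂ, 0 < w.re → ∫ u in Ioi (0 : ℝ), (g u : ℂ) * Complex.exp (-w * u) = G w)
    {l : ℝ} (hl : 0 < l) :
    Tendsto (fun y => ∫ u in Ioi (0 : ℝ), g u * sinc (l * (y - u) / 2) ^ 2) atTop (𝓝 0) := by
  have key : Tendsto (fun y : ℝ => ∫ t in (-1 : ℝ)..1, ((1 - |t| : ℝ) : ℂ) *
      Complex.exp (Complex.I * t * (l * y)) * G (Complex.I * (l * t))) atTop (𝓝 0) := by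
    have h := Real.tendsto_integral_exp_smul_cocompact
      ((Ioc (-1 : ℝ) 1).indicator fun t : ℝ => ((1 - |t| : ℝ) : ℂ) * G (Complex.I * (l * t)))
    have h2 : Tendsto (fun y : ℝ => -(l * y / (2 * π))) atTop (cocompact ℝ) := by
      refine Tendsto.mono_right ?_ atBot_le_cocompact
      exact tendsto_neg_atTop_atBot.comp
        ((tendsto_id.const_mul_atTop hl).atTop_div_const (by positivity))
    refine (h.comp h2).congr fun y => ?_
    simp only [Function.comp]
    rw [intervalIntegral.integral_of_le (by norm_num), ← integral_indicator measurableSet_Ioc]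
    congr 1
    ext t
    by_cases ht : t ∈ Ioc (-1 : ℝ) 1
    · simp only [indicator_of_mem ht, Circle.smul_def, Real.fourierChar_apply, smul_eq_mul]
      have : (2 * π * -(t * -(l * y / (2 * π))) : ℝ) * Complex.I = Complex.I * t * (l * y) := by
        have : (2 * π * -(t * -(l * y / (2 * π))) : ℝ) = t * (l * y) := by
          field_simp
        rw [this]; push_cast; ring
      rw [this]; ring
    · simp [indicator_of_notMem ht]
  have h3 := (Complex.continuous_re.tendsto 0).comp key
  simp only [Complex.zero_re] at h3
  refine h3.congr fun y => ?_
  simp only [Function.comp]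
  rw [← integral_mul_sinc_sq_boundary hgm hgM hG hL hl y]
  have : ∀ u, (g u : ℂ) * ((sinc (l * (y - u) / 2) ^ 2 : ℝ) : ℂ) =
    ((g u * sinc (l * (y - u) / 2) ^ 2 : ℝ) : ℂ) := by intro u; push_cast; ring
  simp_rw [this]
  rw [integral_complex_ofReal, Complex.ofReal_re]

open MeasureTheory Set Topology in
theorem eventually_kernel_bounds {φ : ℝ → ℝ} {B : ℝ} (h0 : ∀ u, 0 ≤ φ u) (hB : ∀ u, φ u ≤ B)
    (hmono : Monotone fun u => Real.exp u * φ u) {k : ℝ → ℝ} (hk0 : ∀ v, 0 ≤ k v)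
    (hki : Integrable k) (hk1 : ∫ v, k v = 1)
    (h : Tendsto (fun y => ∫ u in Ioi (0 : ℝ), (φ u - 1) * k (y - u)) atTop (𝓝 0))
    {η : ℝ} (hη : 0 < η) :
    (∀ᶠ y in atTop, φ y * (∫ v in Icc (-η) η, k v) ≤ Real.exp (2 * η) * (1 + η)) ∧
    (∀ᶠ y in atTop, 1 - η ≤ Real.exp (2 * η) * φ y * (∫ v in Icc (-η) η, k v) +
      B * (1 - ∫ v in Icc (-η) η, k v)) := by
  have hφm : Measurable φ := by
    have : φ = fun u => Real.exp (-u) * (Real.exp u * φ u) := by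
      ext u; rw [← mul_assoc, ← Real.exp_add]; simp
    rw [this]
    exact (by fun_prop : Measurable fun u : ℝ => Real.exp (-u)).mul hmono.measurable
  have hki' : ∀ y, Integrable (fun u => k (y - u)) := fun y => hki.comp_sub_left y
  have hφk : ∀ y, Integrable (fun u => φ u * k (y - u)) := by
    intro y
    refine (hki' y).bdd_mul (c := B) hφm.aestronglyMeasurable (Eventually.of_forall fun u => ?_)
    rw [Real.norm_of_nonneg (h0 u)]; exact hB u
  have hP : Tendsto (fun y => ∫ u in Ioi (0 : ℝ), φ u * k (y - u)) atTop (𝓝 1) := by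
    have h1 : Tendsto (fun y => ∫ u in Ioi (0 : ℝ), k (y - u)) atTop (𝓝 1) := by
      have := (aecover_Iio (μ := volume) (tendsto_id (α := ℝ))
        (l := atTop)).integral_tendsto_of_countably_generated hki
      rw [hk1] at this
      refine this.congr fun y => ?_
      rw [← integral_indicator measurableSet_Ioi, ← integral_indicator measurableSet_Iio,
        ← integral_sub_left_eq_self _ volume y]
      congr 1
      ext u
      simp [indicator_apply]
    have := h.add h1
    rw [zero_add] at this
    refine this.congr fun y => ?_
    rw [← integral_add]
    · congr 1; ext u; ring
    · simp only [sub_mul, one_mul]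
      exact ((hφk y).sub (hki' y)).integrableOn
    · exact (hki' y).integrableOn
  have hJ : ∀ y, ∫ v in Icc (-η) η, k v = ∫ u, (Icc (-η) η).indicator k (y - u) := by
    intro y
    rw [integral_sub_left_eq_self _ volume y, integral_indicator measurableSet_Icc]
  have hJi : ∀ y, Integrable (fun u => (Icc (-η) η).indicator k (y - u)) := fun y =>
    (hki.indicator measurableSet_Icc).comp_sub_left y
  constructor
  · have h1 : ∀ᶠ y in atTop, ∫ u in Ioi (0 : ℝ), φ u * k (y + η - u) ≤ 1 + η := by
      have := (hP.comp (tendsto_atTop_add_const_right atTop η tendsto_id))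
      exact (this.eventually (eventually_le_nhds (by linarith : (1 : ℝ) < 1 + η)))
    filter_upwards [h1, eventually_gt_atTop 0] with y hy hy0
    rw [← div_le_iff₀' (Real.exp_pos _)]
    refine le_trans ?_ hy
    rw [hJ (y + η), ← integral_indicator measurableSet_Ioi, mul_div_right_comm,
      ← integral_const_mul]
    refine integral_mono ((hJi _).const_mul _) ((hφk _).indicator measurableSet_Ioi) fun u => ?_
    simp only [indicator_apply, mem_Icc, mem_Ioi]
    split_ifs with ha hb hb
    · refine mul_le_mul_of_nonneg_right ?_ (hk0 _)
      rw [div_le_iff₀ (Real.exp_pos _)]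
      have hyu : y ≤ u := by linarith [ha.2]
      have := hmono hyu
      simp only at this
      have h2 : Real.exp u ≤ Real.exp (2 * η) * Real.exp y := by
        rw [← Real.exp_add]; exact Real.exp_le_exp.mpr (by linarith [ha.1])
      have h3 : Real.exp y * φ y ≤ Real.exp y * (φ u * Real.exp (2 * η)) := by
        refine this.trans ?_
        have := mul_le_mul_of_nonneg_right h2 (h0 u)
        linarith
      exact le_of_mul_le_mul_left h3 (Real.exp_pos _)
    · exfalso; linarith [ha.2]
    · rw [mul_zero]; exact mul_nonneg (h0 _) (hk0 _)
    · simp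
  · have h1 : ∀ᶠ y in atTop, 1 - η ≤ ∫ u in Ioi (0 : ℝ), φ u * k (y - η - u) := by
      have := (hP.comp (tendsto_atTop_add_const_right atTop (-η) tendsto_id))
      exact (this.eventually (eventually_ge_nhds (by linarith : (1 : ℝ) - η < 1)))
    filter_upwards [h1] with y hy
    refine hy.trans ?_
    have hk1' : (1 : ℝ) = ∫ u, k (y - η - u) := by
      rw [integral_sub_left_eq_self k volume, hk1]
    rw [hJ (y - η)]
    rw [hk1']
    have hdiff : Integrable fun u => k (y - η - u) - (Icc (-η) η).indicator k (y - η - u) :=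
      (hki' _).sub (hJi _)
    rw [← integral_indicator measurableSet_Ioi, ← integral_sub (hki' _) (hJi _),
      ← integral_const_mul, ← integral_const_mul, ← integral_add ((hJi _).const_mul _)
        (hdiff.const_mul _)]
    refine integral_mono ((hφk _).indicator measurableSet_Ioi)
      (((hJi _).const_mul _).add (hdiff.const_mul _)) fun u => ?_
    have hB0 : 0 ≤ B := (h0 0).trans (hB 0)
    simp only [indicator_apply, mem_Icc, mem_Ioi]
    split_ifs with ha hb hb
    · rw [sub_self, mul_zero, add_zero]
      refine mul_le_mul_of_nonneg_right ?_ (hk0 _)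
      have hyu : u ≤ y := by linarith [hb.1]
      have := hmono hyu
      simp only at this
      have h2 : Real.exp y ≤ Real.exp (2 * η) * Real.exp u := by
        rw [← Real.exp_add]; exact Real.exp_le_exp.mpr (by linarith [hb.2])
      have h3 : Real.exp u * φ u ≤ Real.exp u * (Real.exp (2 * η) * φ y) := by
        refine this.trans ?_
        have := mul_le_mul_of_nonneg_right h2 (h0 y)
        linarith
      exact le_of_mul_le_mul_left h3 (Real.exp_pos _)
    · rw [mul_zero, zero_add, sub_zero]
      exact mul_le_mul_of_nonneg_right (hB _) (hk0 _)
    · rw [sub_self, mul_zero, add_zero]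
      exact mul_nonneg (mul_nonneg (Real.exp_pos _).le (h0 _)) (hk0 _)
    · rw [mul_zero, zero_add, sub_zero]
      exact mul_nonneg hB0 (hk0 _)

open MeasureTheory Set Topology in
theorem tendsto_one_of_laplace {φ : ℝ → ℝ} {B : ℝ} (h0 : ∀ u, 0 ≤ φ u) (hB : ∀ u, φ u ≤ B)
    (hmono : Monotone fun u => Real.exp u * φ u) {G : ℂ → ℂ} (hG : Continuous G)
    (hL : ∀ w : ℂ, 0 < w.re →
      ∫ u in Ioi (0 : ℝ), ((φ u - 1 : ℝ) : ℂ) * Complex.exp (-w * u) = G w) :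
    Tendsto φ atTop (𝓝 1) := by
  have hφm : Measurable φ := by
    have : φ = fun u => Real.exp (-u) * (Real.exp u * φ u) := by
      ext u; rw [← mul_assoc, ← Real.exp_add]; simp
    rw [this]
    exact (by fun_prop : Measurable fun u : ℝ => Real.exp (-u)).mul hmono.measurable
  set I := ∫ v : ℝ, sinc (v / 2) ^ 2 with hI
  have hIpos : 0 < I := integral_sinc_sq_pos
  let K : ℝ → ℝ := fun v => sinc (v / 2) ^ 2 / I
  have hK1 : ∫ v, K v = 1 := by
    simp only [K]; rw [integral_div, ← hI, div_self hIpos.ne']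
  have hKi : Integrable K := integrable_sinc_sq.div_const I
  have hK0 : ∀ v, 0 ≤ K v := fun v => by positivity
  have hkern : ∀ l : ℝ, 0 < l → ∀ η : ℝ, 0 < η →
      (∀ᶠ y in atTop, φ y * (∫ v in Icc (-(l * η)) (l * η), K v) ≤ Real.exp (2 * η) * (1 + η)) ∧
      (∀ᶠ y in atTop, 1 - η ≤ Real.exp (2 * η) * φ y * (∫ v in Icc (-(l * η)) (l * η), K v) +
        B * (1 - ∫ v in Icc (-(l * η)) (l * η), K v)) := by
    intro l hl η hη
    have := eventually_kernel_bounds h0 hB hmono (k := fun v => l * K (l * v))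
      (fun v => mul_nonneg hl.le (hK0 _)) ((hKi.comp_mul_left' hl.ne').const_mul l)
      (by rw [integral_const_mul, Measure.integral_comp_mul_left, hK1, abs_of_pos (by positivity)]
          simp [hl.ne']) (by
        have := (tendsto_integral_mul_sinc_sq (g := fun u => φ u - 1) (M := B + 1)
          (hφm.sub_const 1) (fun u => by
            rw [abs_le]; constructor <;> linarith [h0 u, hB u, (h0 0).trans (hB 0)]) hG hL hl)
        have := this.const_mul (l / I)
        rw [mul_zero] at this
        refine this.congr fun y => ?_
        rw [← integral_const_mul]
        congr 1
        ext u
        simp only [K]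
        ring) hη
    have e : ∫ v in Icc (-η) η, l * K (l * v) = ∫ v in Icc (-(l * η)) (l * η), K v := by
      rw [integral_Icc_eq_integral_Ioc, integral_Icc_eq_integral_Ioc,
        ← intervalIntegral.integral_of_le (by linarith),
        ← intervalIntegral.integral_of_le (by nlinarith),
        intervalIntegral.integral_const_mul, intervalIntegral.mul_integral_comp_mul_left]
      simp
    rwa [e] at this
  have hJ : Tendsto (fun N : ℝ => ∫ v in Icc (-N) N, K v) atTop (𝓝 1) := by
    rw [← hK1]
    exact (aecover_Icc (μ := volume) tendsto_neg_atTop_atBot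
      tendsto_id).integral_tendsto_of_countably_generated hKi
  have hinv : Tendsto (fun N : ℝ => N⁻¹) atTop (𝓝 0) := tendsto_inv_atTop_zero
  have hE : Tendsto (fun N : ℝ => Real.exp (2 * N⁻¹)) atTop (𝓝 1) := by
    have := (Real.continuous_exp.tendsto _).comp (hinv.const_mul 2)
    simpa [Function.comp_def] using this
  have hbd : ∀ N : ℝ, 0 < N →
      (∀ᶠ y in atTop, φ y * (∫ v in Icc (-N) N, K v) ≤ Real.exp (2 * N⁻¹) * (1 + N⁻¹)) ∧
      (∀ᶠ y in atTop, 1 - N⁻¹ ≤ Real.exp (2 * N⁻¹) * φ y * (∫ v in Icc (-N) N, K v) +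
        B * (1 - ∫ v in Icc (-N) N, K v)) := by
    intro N hN
    have := hkern (N ^ 2) (by positivity) N⁻¹ (by positivity)
    have e : N ^ 2 * N⁻¹ = N := by field_simp
    rwa [e] at this
  rw [tendsto_order]
  constructor
  · intro a ha
    have hT : Tendsto (fun N : ℝ => (1 - N⁻¹ - B * (1 - ∫ v in Icc (-N) N, K v)) -
        Real.exp (2 * N⁻¹) * (∫ v in Icc (-N) N, K v) * a) atTop (𝓝 (1 - a)) := by
      have := ((hinv.const_sub 1).sub ((hJ.const_sub 1).const_mul B)).sub
        ((hE.mul hJ).mul_const a)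
      simpa using this
    obtain ⟨N, hN, hN0, hN1⟩ := ((hT.eventually (lt_mem_nhds (by linarith : 0 < 1 - a))).and
      ((eventually_gt_atTop 0).and (hJ.eventually (lt_mem_nhds (zero_lt_one))))).exists
    filter_upwards [(hbd N hN0).2] with y hy
    have h4 : 0 < Real.exp (2 * N⁻¹) * (∫ v in Icc (-N) N, K v) :=
      mul_pos (Real.exp_pos _) hN1
    nlinarith
  · intro a ha
    have hT : Tendsto (fun N : ℝ => (∫ v in Icc (-N) N, K v) * a -
        Real.exp (2 * N⁻¹) * (1 + N⁻¹)) atTop (𝓝 (a - 1)) := by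
      have := (hJ.mul_const a).sub (hE.mul (hinv.const_add 1))
      simpa using this
    obtain ⟨N, hN, hN0, hN1⟩ := ((hT.eventually (lt_mem_nhds (by linarith : 0 < a - 1))).and
      ((eventually_gt_atTop 0).and (hJ.eventually (lt_mem_nhds (zero_lt_one))))).exists
    filter_upwards [(hbd N hN0).1] with y hy
    nlinarith

open MeasureTheory Set Topology ArithmeticFunction.vonMangoldt in
theorem integral_psi_exp {w : ℂ} (hw : 0 < w.re) :
    ∫ u in Ioi (0 : ℝ), ((Chebyshev.psi (Real.exp u) * Real.exp (-u) - 1 : ℝ) : ℂ) *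
      Complex.exp (-w * u) = (LFunctionResidueClassAux (1 : ZMod 1) (1 + w) - 1) / (1 + w) := by
  have hw1 : 1 + w ≠ 0 := by
    intro h
    have := congrArg Complex.re h
    simp at this; linarith
  have hw0 : w ≠ 0 := by rintro rfl; simp at hw
  have hs1 : 1 < (1 + w).re := by simpa using hw
  have hres : (fun n : ℕ => ((residueClass (1 : ZMod 1) n : ℝ) : ℂ)) =
      fun n => ((ArithmeticFunction.vonMangoldt n : ℝ) : ℂ) := by
    ext n
    have : (n : ZMod 1) = 1 := Subsingleton.elim _ _
    simp [residueClass, this]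
  have hR := eqOn_LFunctionResidueClassAux (q := 1) (a := 1) isUnit_one hs1
  simp only [hres, Nat.totient_one, Nat.cast_one, inv_one, add_sub_cancel_left] at hR
  have hpsi : ∀ n : ℕ, ∑ k ∈ Finset.Icc 1 n, ArithmeticFunction.vonMangoldt k =
      Chebyshev.psi n := by
    intro n
    rw [Chebyshev.psi, Nat.floor_natCast]
    rfl
  have hLS := LSeries_eq_mul_integral_of_nonneg (fun n => ArithmeticFunction.vonMangoldt n)
    (r := 1) zero_le_one hs1 (by
      simp only [hpsi, Real.rpow_one]
      refine Asymptotics.IsBigO.of_bound (Real.log 4 + 4) (Eventually.of_forall fun n => ?_)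
      rw [Real.norm_of_nonneg (Chebyshev.psi_nonneg _), Real.norm_of_nonneg (Nat.cast_nonneg _)]
      exact Chebyshev.psi_le_const_mul_self (Nat.cast_nonneg _))
    (fun n => ArithmeticFunction.vonMangoldt_nonneg)
  have hsub : ∫ t in Ioi (1 : ℝ), (∑ k ∈ Finset.Icc 1 ⌊t⌋₊,
      ((ArithmeticFunction.vonMangoldt k : ℝ) : ℂ)) * (t : ℂ) ^ (-(1 + w + 1)) =
      ∫ u in Ioi (0 : ℝ), ((Chebyshev.psi (Real.exp u) * Real.exp (-u) : ℝ) : ℂ) *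
      Complex.exp (-w * u) := by
    have himg : Real.exp '' Ioi 0 = Ioi 1 := by
      ext x
      constructor
      · rintro ⟨u, hu, rfl⟩
        exact Real.one_lt_exp_iff.mpr hu
      · intro hx
        have hx' : (1 : ℝ) < x := hx
        exact ⟨Real.log x, Real.log_pos hx', Real.exp_log (by linarith)⟩
    rw [← himg, integral_image_eq_integral_abs_deriv_smul measurableSet_Ioi
      (fun u _ => (Real.hasDerivAt_exp u).hasDerivWithinAt) (Real.exp_injective.injOn)]
    refine setIntegral_congr_fun measurableSet_Ioi fun u _ => ?_
    have h1 : (∑ k ∈ Finset.Icc 1 ⌊Real.exp u⌋₊, ((ArithmeticFunction.vonMangoldt k : ℝ) : ℂ)) =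
        (Chebyshev.psi (Real.exp u) : ℂ) := by
      rw [← Complex.ofReal_sum, hpsi, ← Chebyshev.psi_eq_psi_coe_floor]
    simp only [h1, abs_of_pos (Real.exp_pos u), Complex.real_smul]
    have h2 : (Real.exp u : ℂ) ≠ 0 := by exact_mod_cast (Real.exp_pos u).ne'
    rw [Complex.cpow_def_of_ne_zero h2, ← Complex.ofReal_log (Real.exp_pos u).le, Real.log_exp]
    have h3 : (Real.exp u : ℂ) * Complex.exp (u * -(1 + w + 1)) =
        (Real.exp (-u) : ℂ) * Complex.exp (-w * u) := by
      push_cast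
      rw [← Complex.exp_add, ← Complex.exp_add]
      congr 1; ring
    push_cast at h3 ⊢
    linear_combination (Chebyshev.psi (Real.exp u) : ℂ) * h3
  have hexp : IntegrableOn (fun u : ℝ => Complex.exp (-w * u)) (Ioi 0) :=
    integrableOn_exp_mul_complex_Ioi (by simpa using hw) 0
  have hexpI : ∫ u in Ioi (0 : ℝ), Complex.exp (-w * u) = 1 / w := by
    rw [integral_exp_mul_complex_Ioi (by simpa using hw)]
    simp
  have hInt : IntegrableOn (fun u : ℝ => ((Chebyshev.psi (Real.exp u) * Real.exp (-u) : ℝ) : ℂ) *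
      Complex.exp (-w * u)) (Ioi 0) := by
    refine Integrable.bdd_mul (c := Real.log 4 + 4) hexp ?_ (Eventually.of_forall fun u => ?_)
    · apply Measurable.aestronglyMeasurable
      have := Chebyshev.psi_mono.measurable
      fun_prop
    · rw [Complex.norm_real, Real.norm_of_nonneg
        (mul_nonneg (Chebyshev.psi_nonneg _) (Real.exp_pos _).le), Real.exp_neg,
        ← div_eq_mul_inv, div_le_iff₀ (Real.exp_pos _)]
      exact Chebyshev.psi_le_const_mul_self (Real.exp_pos _).le
  have e : ∀ u : ℝ, ((Chebyshev.psi (Real.exp u) * Real.exp (-u) - 1 : ℝ) : ℂ) *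
      Complex.exp (-w * u) = ((Chebyshev.psi (Real.exp u) * Real.exp (-u) : ℝ) : ℂ) *
      Complex.exp (-w * u) - Complex.exp (-w * u) := by
    intro u; push_cast; ring
  simp_rw [e]
  rw [integral_sub hInt hexp, hexpI, ← hsub, hR, hLS]
  field_simp
  ring

open Topology ArithmeticFunction.vonMangoldt in
/-- The **Prime Number Theorem** for the Chebyshev function. -/
theorem tendsto_psi_div_atTop :
    Tendsto (fun x : ℝ => Chebyshev.psi x / x) atTop (𝓝 1) := by
  have h := tendsto_one_of_laplace (φ := fun u => Chebyshev.psi (Real.exp u) * Real.exp (-u))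
    (B := Real.log 4 + 4)
    (G := fun w => (LFunctionResidueClassAux (1 : ZMod 1)
      (1 + ((max w.re 0 : ℝ) + w.im * Complex.I)) - 1) / (1 + ((max w.re 0 : ℝ) + w.im * Complex.I)))
    (fun u => mul_nonneg (Chebyshev.psi_nonneg _) (Real.exp_pos _).le)
    (fun u => by
      rw [Real.exp_neg, ← div_eq_mul_inv, div_le_iff₀ (Real.exp_pos _)]
      exact Chebyshev.psi_le_const_mul_self (Real.exp_pos _).le)
    (fun u v huv => by
      have e : ∀ u : ℝ, Real.exp u * (Chebyshev.psi (Real.exp u) * Real.exp (-u)) =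
          Chebyshev.psi (Real.exp u) := by
        intro u
        rw [mul_comm, mul_assoc, ← Real.exp_add]; simp
      simp only [e]
      exact Chebyshev.psi_mono (Real.exp_le_exp.mpr huv))
    (by
      have hre : ∀ w : ℂ, (1 + ((max w.re 0 : ℝ) + w.im * Complex.I) : ℂ).re = 1 + max w.re 0 := by
        intro w; simp
      have hc : Continuous fun w : ℂ => (1 + ((max w.re 0 : ℝ) + w.im * Complex.I) : ℂ) := by
        fun_prop
      refine Continuous.div ?_ hc ?_
      · refine Continuous.sub ?_ continuous_const
        exact (continuousOn_LFunctionResidueClassAux (1 : ZMod 1)).comp_continuous hc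
          fun w => by
            rw [Set.mem_ofPred_eq, hre]; linarith [le_max_right w.re 0]
      · intro w h
        have := hre w
        rw [h, Complex.zero_re] at this
        linarith [le_max_right w.re 0])
    (fun w hw => by
      have : ((max w.re 0 : ℝ) + w.im * Complex.I : ℂ) = w := by
        rw [max_eq_left hw.le, Complex.re_add_im]
      simp only [this]
      exact integral_psi_exp hw)
  refine (h.comp Real.tendsto_log_atTop).congr' ?_
  filter_upwards [eventually_gt_atTop 0] with x hx
  simp only [Function.comp]
  rw [Real.exp_log hx, Real.exp_neg, Real.exp_log hx, div_eq_mul_inv]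

theorem exists_greedy_assignment {h : ℕ} (hh : 1 ≤ h) (w : ℕ → ℝ) :
    ∃ c : ℕ → Fin h, ∀ n j, ∑ k ∈ Finset.range n, (if c k = c n then w k else 0) ≤
      ∑ k ∈ Finset.range n, (if c k = j then w k else 0) := by
  have : Nonempty (Fin h) := ⟨⟨0, hh⟩⟩
  choose a ha using fun f : Fin h → ℝ => Finite.exists_min f
  let E : ℕ → Fin h → ℝ := fun n => Nat.rec (fun _ => 0)
    (fun k e j => e j + if a e = j then w k else 0) n
  have hE : ∀ n j, E n j = ∑ k ∈ Finset.range n, (if a (E k) = j then w k else 0) := by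
    intro n j
    induction n with
    | zero => rfl
    | succ n ih => rw [Finset.sum_range_succ, ← ih]
  refine ⟨fun n => a (E n), fun n j => ?_⟩
  rw [← hE, ← hE]
  exact ha _ _

/-- In a greedy assignment, the class sums stay balanced to within the size of the weights
used since any earlier time after which a large enough total weight was distributed. -/
theorem greedy_sub_le {h : ℕ} {w B : ℕ → ℝ} {c : ℕ → Fin h} (hw : ∀ n, 0 ≤ w n)
    (hwB : ∀ n, w n ≤ B n) (hB : Antitone B)
    (hc : ∀ n j, ∑ k ∈ Finset.range n, (if c k = c n then w k else 0) ≤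
      ∑ k ∈ Finset.range n, (if c k = j then w k else 0))
    {n m : ℕ} (hnm : n ≤ m) (hmass : 2 * h * B 0 < ∑ k ∈ Finset.Ico n m, w k) (i j : Fin h) :
    ∑ k ∈ Finset.range m, (if c k = i then w k else 0) -
      ∑ k ∈ Finset.range m, (if c k = j then w k else 0) ≤ B n := by
  set E : Fin h → ℕ → ℝ := fun i n => ∑ k ∈ Finset.range n, (if c k = i then w k else 0) with hEdef
  change E i m - E j m ≤ B n
  have hEs : ∀ i n, E i (n + 1) = E i n + if c n = i then w n else 0 := fun i n =>
    Finset.sum_range_succ _ _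
  have hmono : ∀ i n, E i n ≤ E i (n + 1) := by
    intro i n
    rw [hEs]
    split_ifs
    · linarith [hw n]
    · simp
  have hmin : ∀ n j, E (c n) n ≤ E j n := hc
  have hB0 : ∀ n, 0 ≤ B n := fun n => (hw n).trans (hwB n)
  have step : ∀ n i j, c n = i → E i (n + 1) - E j (n + 1) ≤ B n := by
    intro n i j hi
    have h1 := hmono j n
    have h2 := hmin n j
    rw [hi] at h2
    rw [hEs i, if_pos hi]
    linarith [hwB n]
  have nstep : ∀ n i, c n ≠ i → E i (n + 1) = E i n := by
    intro n i hi
    rw [hEs, if_neg hi, add_zero]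
  have unif : ∀ n i j, E i n - E j n ≤ B 0 := by
    intro n
    induction n with
    | zero => intro i j; simpa [E] using hB0 0
    | succ n ih =>
      intro i j
      by_cases hi : c n = i
      · exact (step n i j hi).trans (hB (Nat.zero_le _))
      · rw [nstep n i hi]
        linarith [hmono j n, ih i j]
  by_contra! hlt
  have frozen : ∀ m, n ≤ m → B n < E i m - E j m → E i m = E i n := by
    intro m hm
    induction m, hm using Nat.le_induction with
    | base => intro _; rfl
    | succ m hm ih =>
      intro hlt
      by_cases hi : c m = i
      · exact absurd (step m i j hi) (not_le.2 ((hB hm).trans_lt hlt))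
      · have h1 := nstep m i hi
        rw [h1]
        exact ih (by linarith [hmono j m])
  have hf := frozen m hnm hlt
  have htot : ∀ n, ∑ l, E l n = ∑ k ∈ Finset.range n, w k := by
    intro n
    simp only [hEdef]
    rw [Finset.sum_comm]
    simp
  have h1 : ∑ k ∈ Finset.Ico n m, w k = ∑ l, (E l m - E l n) := by
    rw [Finset.sum_Ico_eq_sub _ hnm, Finset.sum_sub_distrib, htot, htot]
  have h2 : ∑ l, (E l m - E l n) ≤ ∑ _l : Fin h, 2 * B 0 := by
    refine Finset.sum_le_sum fun l _ => ?_
    linarith [unif m l i, unif n i l]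
  rw [← h1] at h2
  simp at h2
  linarith

theorem greedy_abs_sub_le {h : ℕ} {w B : ℕ → ℝ} {c : ℕ → Fin h} (hw : ∀ n, 0 ≤ w n)
    (hwB : ∀ n, w n ≤ B n) (hB : Antitone B)
    (hc : ∀ n j, ∑ k ∈ Finset.range n, (if c k = c n then w k else 0) ≤
      ∑ k ∈ Finset.range n, (if c k = j then w k else 0))
    {n m : ℕ} (hnm : n ≤ m) (hmass : 2 * h * B 0 < ∑ k ∈ Finset.Ico n m, w k) (i : Fin h) :
    |∑ k ∈ Finset.range m, ((if c k = i then 1 else 0) - 1 / (h : ℝ)) * w k| ≤ B n := by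
  have hh : (0 : ℝ) < h := by exact_mod_cast i.pos
  have key := fun i j => greedy_sub_le hw hwB hB hc hnm hmass i j
  set E : Fin h → ℝ := fun i => ∑ k ∈ Finset.range m, (if c k = i then w k else 0) with hEdef
  have htot : ∑ l, E l = ∑ k ∈ Finset.range m, w k := by
    simp only [hEdef]
    rw [Finset.sum_comm]
    simp
  have h1 : ∑ k ∈ Finset.range m, ((if c k = i then 1 else 0) - 1 / (h : ℝ)) * w k =
      (1 / h) * ∑ l, (E i - E l) := by
    rw [Finset.sum_sub_distrib, htot]
    simp only [sub_mul, Finset.sum_sub_distrib, ite_mul, one_mul, zero_mul, ← Finset.mul_sum,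
      Finset.sum_const, Finset.card_univ, Fintype.card_fin, nsmul_eq_mul, hEdef]
    field_simp
  have e1 : ∑ l, (E i - E l) ≤ h * B n := by
    calc _ ≤ ∑ _l : Fin h, B n := Finset.sum_le_sum fun l _ => key i l
      _ = _ := by simp
  have e2 : -(h * B n) ≤ ∑ l, (E i - E l) := by
    calc -(h * B n) = ∑ _l : Fin h, (-B n) := by simp
      _ ≤ _ := Finset.sum_le_sum fun l _ => by have := key l i; simp only [E]; linarith
  rw [h1, abs_mul, abs_of_pos (by positivity), one_div, inv_mul_le_iff₀ hh]
  exact abs_le.2 ⟨e2, e1⟩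

open Topology in
theorem tendsto_theta_div_atTop :
    Tendsto (fun x : ℝ => Chebyshev.theta x / x) atTop (𝓝 1) := by
  have h1 : Tendsto (fun x : ℝ => (Chebyshev.psi x - Chebyshev.theta x) / x) atTop (𝓝 0) := by
    have h0 : Real.sqrt =o[atTop] fun x : ℝ => x := by
      refine (Asymptotics.isLittleO_iff_tendsto' ?_).2 ?_
      · filter_upwards [eventually_gt_atTop 0] with x hx h
        exact absurd h hx.ne'
      · refine (tendsto_inv_atTop_zero.comp Real.tendsto_sqrt_atTop).congr fun x => ?_
        rw [Function.comp_apply, Real.sqrt_div_self', one_div]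
    exact (Chebyshev.isBigO_psi_sub_theta_sqrt.trans_isLittleO h0).tendsto_div_nhds_zero
  have := tendsto_psi_div_atTop.sub h1
  simp only [sub_zero] at this
  refine this.congr fun x => ?_
  ring

/-- The weight `-log (1 - 1 / p)` of a prime `p`, and `0` at other integers. -/
noncomputable def primeWeight (n : ℕ) : ℝ := if n.Prime then -log (1 - 1 / (n : ℝ)) else 0

theorem primeWeight_nonneg (n : ℕ) : 0 ≤ primeWeight n := by
  unfold primeWeight
  split_ifs with h
  · have : (2 : ℝ) ≤ n := by exact_mod_cast h.two_le
    have h1 : 1 / (n : ℝ) ≤ 1 / 2 := by gcongr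
    have h2 : 0 < 1 / (n : ℝ) := by positivity
    have := Real.log_nonpos (x := 1 - 1 / (n : ℝ)) (by linarith) (by linarith)
    linarith
  · rfl

theorem primeWeight_le (n : ℕ) : primeWeight n ≤ 3 / ((n : ℝ) + 1) := by
  unfold primeWeight
  split_ifs with h
  · have : (2 : ℝ) ≤ n := by exact_mod_cast h.two_le
    have h1 : 1 - 1 / (n : ℝ) = ((n : ℝ) - 1) / n := by field_simp
    have h2 := Real.log_le_sub_one_of_pos (x := (n : ℝ) / (n - 1)) (by apply div_pos <;> linarith)
    rw [h1, ← Real.log_inv, inv_div]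
    refine h2.trans ?_
    have : (n : ℝ) / (n - 1) - 1 = 1 / (n - 1) := by
      have : (n : ℝ) - 1 ≠ 0 := by linarith
      field_simp; ring
    rw [this, div_le_div_iff₀ (by linarith) (by linarith)]
    linarith
  · positivity

theorem le_primeWeight {n : ℕ} (hn : n.Prime) : 1 / (n : ℝ) ≤ primeWeight n := by
  have : (2 : ℝ) ≤ n := by exact_mod_cast hn.two_le
  have h1 : 1 / (n : ℝ) ≤ 1 / 2 := by gcongr
  have := Real.log_le_sub_one_of_pos (x := 1 - 1 / (n : ℝ)) (by linarith)
  rw [primeWeight, if_pos hn]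
  linarith

theorem exists_lt_sum_primeWeight (M : ℝ) : ∃ K J₀ : ℕ, 1 ≤ K ∧ ∀ J ≥ J₀,
    M < ∑ k ∈ Finset.Ico (2 ^ J + 1) (2 ^ (K * J) + 1), primeWeight k := by
  set T : ℕ → ℝ := fun j => ∑ k ∈ Finset.range (2 ^ j + 1), primeWeight k with hT
  have hdy : ∀ᶠ x : ℝ in atTop, 2 * x / 4 ≤ Chebyshev.theta (2 * x) - Chebyshev.theta x := by
    have h1 := tendsto_theta_div_atTop.comp (tendsto_id.const_mul_atTop (zero_lt_two' ℝ))
    have h2 := h1.sub (tendsto_theta_div_atTop.const_mul (1 / 2))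
    have h3 := h2.eventually (lt_mem_nhds (a := (1 / 4 : ℝ)) (by norm_num))
    filter_upwards [h3, eventually_gt_atTop 0] with x hx hx0
    simp only [Function.comp_apply, id_eq] at hx
    have : Chebyshev.theta (2 * x) / (2 * x) - 1 / 2 * (Chebyshev.theta x / x) =
      (Chebyshev.theta (2 * x) - Chebyshev.theta x) / (2 * x) := by field_simp
    rw [this, lt_div_iff₀ (by linarith)] at hx
    linarith
  have hp : Tendsto (fun j : ℕ => (2 : ℝ) ^ j) atTop atTop :=
    tendsto_pow_atTop_atTop_of_one_lt (by norm_num)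
  obtain ⟨J₀, hJ₀⟩ := eventually_atTop.1 (hp.eventually hdy)
  have hstep : ∀ j ≥ J₀, 1 / (4 * ((j : ℝ) + 1)) ≤ T (j + 1) - T j := by
    intro j hj
    have h1 := hJ₀ j hj
    have e1 : (2 : ℝ) * 2 ^ j = ((2 ^ (j + 1) : ℕ) : ℝ) := by push_cast; ring
    have e2 : (2 : ℝ) ^ j = ((2 ^ j : ℕ) : ℝ) := by push_cast; ring
    have hth : ∀ n : ℕ, Chebyshev.theta n =
        ∑ k ∈ Finset.range (n + 1), if k.Prime then log k else 0 := by
      intro n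
      rw [Chebyshev.theta_eq_sum_Icc, Nat.floor_natCast, Finset.sum_filter,
        Finset.range_eq_Ico]
      rfl
    have hle : 2 ^ j + 1 ≤ 2 ^ (j + 1) + 1 := by gcongr <;> omega
    rw [e1, e2, hth, hth, ← Finset.sum_Ico_eq_sub _ hle] at h1
    simp only [hT]
    rw [← Finset.sum_Ico_eq_sub _ hle]
    have hpos : (0 : ℝ) < (2 ^ (j + 1) : ℕ) := by positivity
    have h2 : ∑ k ∈ Finset.Ico (2 ^ j + 1) (2 ^ (j + 1) + 1), (if Nat.Prime k then log k else 0) ≤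
        ∑ k ∈ Finset.Ico (2 ^ j + 1) (2 ^ (j + 1) + 1),
          (((2 ^ (j + 1) : ℕ) : ℝ) * (j + 1)) * primeWeight k := by
      refine Finset.sum_le_sum fun k hk => ?_
      split_ifs with hkp
      · have hk2 := (Finset.mem_Ico.1 hk).2
        have hk3 : (k : ℝ) ≤ (2 ^ (j + 1) : ℕ) := by exact_mod_cast Nat.lt_succ_iff.1 hk2
        have hk0 : (0 : ℝ) < k := by exact_mod_cast hkp.pos
        have h3 : log k ≤ j + 1 := by
          calc log k ≤ log ((2 ^ (j + 1) : ℕ) : ℝ) := Real.log_le_log hk0 hk3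
            _ = (j + 1) * log 2 := by push_cast; rw [Real.log_pow]; push_cast; ring
            _ ≤ (j + 1) * 1 := by gcongr; linarith [Real.log_two_lt_d9]
            _ = _ := mul_one _
        have h4 := le_primeWeight hkp
        have h5 : 1 ≤ ((2 ^ (j + 1) : ℕ) : ℝ) * primeWeight k := by
          calc (1 : ℝ) = k * (1 / k) := by field_simp
            _ ≤ _ := by gcongr
        nlinarith
      · exact mul_nonneg (by positivity) (primeWeight_nonneg k)
    rw [← Finset.mul_sum] at h2
    have h3 := h1.trans h2
    rw [div_le_iff₀ (by positivity)]
    have h4 : ((2 ^ (j + 1) : ℕ) : ℝ) * (1 / 4) ≤ ((2 ^ (j + 1) : ℕ) : ℝ) * ((j + 1) *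
      ∑ k ∈ Finset.Ico (2 ^ j + 1) (2 ^ (j + 1) + 1), primeWeight k) := by linarith
    have := le_of_mul_le_mul_left h4 hpos
    linarith
  have hdouble : ∀ J ≥ J₀ + 1, 1 / 8 ≤ T (2 * J) - T J := by
    intro J hJ
    rw [← Finset.sum_Ico_sub T (by omega : J ≤ 2 * J)]
    have hJ0 : (0 : ℝ) < J := by exact_mod_cast (by omega : 0 < J)
    calc (1 / 8 : ℝ) = ∑ _j ∈ Finset.Ico J (2 * J), 1 / (4 * (2 * (J : ℝ))) := by
          simp only [Finset.sum_const, Nat.card_Ico, nsmul_eq_mul]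
          rw [show 2 * J - J = J by omega]
          field_simp; norm_num
      _ ≤ _ := by
          refine Finset.sum_le_sum fun j hj => (?_ : _ ≤ _).trans (hstep j ?_)
          · have : (j : ℝ) + 1 ≤ 2 * J := by exact_mod_cast (Finset.mem_Ico.1 hj).2
            gcongr
          · have := (Finset.mem_Ico.1 hj).1; omega
  have hiter : ∀ s : ℕ, ∀ J ≥ J₀ + 1, (s : ℝ) / 8 ≤ T (2 ^ s * J) - T J := by
    intro s
    induction s with
    | zero => intro J _; simp
    | succ s ih =>
      intro J hJ
      have h1 := ih J hJ
      have h2 := hdouble (2 ^ s * J) (hJ.trans (Nat.le_mul_of_pos_left _ (by positivity)))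
      rw [show 2 * (2 ^ s * J) = 2 ^ (s + 1) * J by ring] at h2
      push_cast
      linarith
  obtain ⟨s, hs⟩ := exists_nat_gt (8 * M)
  refine ⟨2 ^ s, J₀ + 1, Nat.one_le_two_pow, fun J hJ => ?_⟩
  have h1 := hiter s J hJ
  rw [Finset.sum_Ico_eq_sub]
  · simp only [hT] at h1
    linarith
  · gcongr
    · norm_num
    · exact Nat.le_mul_of_pos_left _ (by positivity)

open Topology in
/-- The primes can be split into `h` classes which share the weights `-log (1 - 1 / p)` equally,
with discrepancy smaller than `1 / log`. -/
theorem exists_balanced_assignment {h : ℕ} (hh : 1 ≤ h) : ∃ c : ℕ → Fin h, ∀ i,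
    Tendsto (fun m : ℕ => (∑ k ∈ Finset.range m,
      ((if c k = i then 1 else 0) - 1 / (h : ℝ)) * primeWeight k) * log m) atTop (𝓝 0) := by
  obtain ⟨c, hc⟩ := exists_greedy_assignment hh primeWeight
  refine ⟨c, fun i => ?_⟩
  have hB : Antitone fun n : ℕ => 3 / ((n : ℝ) + 1) := fun a b hab => by dsimp only; gcongr
  obtain ⟨K, J₀, hK, hmass⟩ := exists_lt_sum_primeWeight (2 * h * (3 / (((0 : ℕ) : ℝ) + 1)))
  have hJ : Tendsto (fun m : ℕ => Nat.log 2 (m - 1) / K) atTop atTop := by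
    refine tendsto_atTop.2 fun b => ?_
    filter_upwards [eventually_ge_atTop (2 ^ (b * K) + 1)] with m hm
    rw [Nat.le_div_iff_mul_le (by omega)]
    exact Nat.le_log_of_pow_le (by norm_num) (by omega)
  have hlim : Tendsto (fun J : ℕ => 3 * K * (((J : ℝ) + 1) * (1 / 2) ^ J)) atTop (𝓝 0) := by
    have h1 := tendsto_self_mul_const_pow_of_lt_one (r := (1 / 2 : ℝ)) (by norm_num) (by norm_num)
    have h2 := tendsto_pow_atTop_nhds_zero_of_lt_one (r := (1 / 2 : ℝ)) (by norm_num) (by norm_num)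
    have := (h1.add h2).const_mul (3 * (K : ℝ))
    simp only [add_zero, mul_zero] at this
    exact this.congr fun J => by ring
  refine squeeze_zero_norm' ?_ (hlim.comp hJ)
  filter_upwards [hJ.eventually (eventually_ge_atTop J₀), eventually_ge_atTop 2] with m hm hm2
  set J := Nat.log 2 (m - 1) / K with hJdef
  have hl := Nat.pow_log_le_self 2 (x := m - 1) (by omega)
  have hu := Nat.lt_pow_succ_log_self (b := 2) (by norm_num) (m - 1)
  have hKJ : K * J ≤ Nat.log 2 (m - 1) := Nat.mul_div_le _ _
  have hKJ2 : Nat.log 2 (m - 1) + 1 ≤ K * (J + 1) := by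
    have := Nat.lt_mul_div_succ (Nat.log 2 (m - 1)) (b := K) (by omega)
    rw [← hJdef] at this
    omega
  have hm1 : 2 ^ (K * J) + 1 ≤ m := by
    have := (Nat.pow_le_pow_right (n := 2) (by norm_num) hKJ).trans hl
    omega
  have hm3 : m ≤ 2 ^ (K * (J + 1)) := by
    have := Nat.pow_le_pow_right (n := 2) (by norm_num) hKJ2
    omega
  have hJm : 2 ^ J + 1 ≤ 2 ^ (K * J) + 1 := by
    gcongr
    · norm_num
    · exact Nat.le_mul_of_pos_left _ (by omega)
  have hmass' : 2 * h * (3 / (((0 : ℕ) : ℝ) + 1)) <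
      ∑ k ∈ Finset.Ico (2 ^ J + 1) m, primeWeight k := by
    refine (hmass J hm).trans_le ?_
    exact Finset.sum_le_sum_of_subset_of_nonneg (Finset.Ico_subset_Ico_right hm1)
      fun _ _ _ => primeWeight_nonneg _
  have hd := greedy_abs_sub_le primeWeight_nonneg primeWeight_le hB hc (hJm.trans hm1) hmass' i
  have hlog : log m ≤ K * (J + 1) := by
    calc log m ≤ log ((2 ^ (K * (J + 1)) : ℕ) : ℝ) :=
          Real.log_le_log (by exact_mod_cast (by omega : 0 < m)) (by exact_mod_cast hm3)
      _ = (K * (J + 1)) * log 2 := by push_cast; rw [Real.log_pow]; push_cast; ring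
      _ ≤ (K * (J + 1)) * 1 := by gcongr; linarith [Real.log_two_lt_d9]
      _ = _ := mul_one _
  have hlog0 : 0 ≤ log m := Real.log_natCast_nonneg _
  rw [norm_mul, Real.norm_eq_abs, Real.norm_eq_abs, abs_of_nonneg hlog0]
  have hd2 : 3 / (((2 ^ J + 1 : ℕ) : ℝ) + 1) ≤ 3 * (1 / 2) ^ J := by
    rw [one_div, inv_pow, ← div_eq_mul_inv]
    push_cast
    gcongr
    linarith
  calc _ ≤ (3 * (1 / 2) ^ J) * (K * ((J : ℝ) + 1)) := by
        gcongr
        exact hd.trans hd2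
    _ = _ := by simp only [Function.comp_apply]; ring

theorem abs_sum_sub_mul_le_of_monotone {D g : ℕ → ℝ} {s : ℝ} {M N : ℕ} (hMN : M ≤ N)
    (hD : ∀ k ≥ M, |D k| ≤ s) (hg : ∀ k ≥ M, g k ≤ g (k + 1)) (h0 : 0 ≤ g M) :
    |∑ k ∈ Finset.Ico M N, (D (k + 1) - D k) * g k| ≤ 2 * s * g N := by
  have hgN : 0 ≤ g N := by
    induction N, hMN using Nat.le_induction with
    | base => exact h0
    | succ n hn ih => exact ih.trans (hg n hn)
  have key : |∑ k ∈ Finset.Ico M N, (D (k + 1) - D k) * g k - D N * g N| ≤ s * g N := by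
    clear hgN
    induction N, hMN using Nat.le_induction with
    | base =>
      simp only [Finset.Ico_self, Finset.sum_empty, zero_sub, abs_neg, abs_mul, abs_of_nonneg h0]
      exact mul_le_mul_of_nonneg_right (hD M le_rfl) h0
    | succ n hn ih =>
      rw [Finset.sum_Ico_succ_top hn]
      have h1 : |D (n + 1) * (g (n + 1) - g n)| ≤ s * (g (n + 1) - g n) := by
        have := sub_nonneg.2 (hg n hn)
        rw [abs_mul, abs_of_nonneg this]
        exact mul_le_mul_of_nonneg_right (hD _ (by omega)) this
      have e : ∑ k ∈ Finset.Ico M n, (D (k + 1) - D k) * g k + (D (n + 1) - D n) * g n -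
          D (n + 1) * g (n + 1) = (∑ k ∈ Finset.Ico M n, (D (k + 1) - D k) * g k - D n * g n) -
          D (n + 1) * (g (n + 1) - g n) := by ring
      rw [e]
      refine (abs_sub _ _).trans ?_
      linarith
  have h2 : |D N * g N| ≤ s * g N := by
    rw [abs_mul, abs_of_nonneg hgN]
    exact mul_le_mul_of_nonneg_right (hD N hMN) hgN
  have := abs_sub_abs_le_abs_sub (∑ k ∈ Finset.Ico M N, (D (k + 1) - D k) * g k) (D N * g N)
  linarith

theorem abs_sum_sub_mul_le_of_antitone {D g : ℕ → ℝ} {s : ℝ} {M N : ℕ} (hMN : M ≤ N)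
    (hD : ∀ k ≥ M, |D k| ≤ s) (hg : ∀ k ≥ M, g (k + 1) ≤ g k) (h0 : ∀ k ≥ M, 0 ≤ g k) :
    |∑ k ∈ Finset.Ico M N, (D (k + 1) - D k) * g k| ≤ 2 * s * g M := by
  have key : |∑ k ∈ Finset.Ico M N, (D (k + 1) - D k) * g k - D N * g N| ≤
      s * (2 * g M - g N) := by
    induction N, hMN using Nat.le_induction with
    | base =>
      simp only [Finset.Ico_self, Finset.sum_empty, zero_sub, abs_neg, abs_mul,
        abs_of_nonneg (h0 M le_rfl)]
      refine (mul_le_mul_of_nonneg_right (hD M le_rfl) (h0 M le_rfl)).trans (le_of_eq (by ring))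
    | succ n hn ih =>
      rw [Finset.sum_Ico_succ_top hn]
      have h1 : |D (n + 1) * (g n - g (n + 1))| ≤ s * (g n - g (n + 1)) := by
        have := sub_nonneg.2 (hg n hn)
        rw [abs_mul, abs_of_nonneg this]
        exact mul_le_mul_of_nonneg_right (hD _ (by omega)) this
      have e : ∑ k ∈ Finset.Ico M n, (D (k + 1) - D k) * g k + (D (n + 1) - D n) * g n -
          D (n + 1) * g (n + 1) = (∑ k ∈ Finset.Ico M n, (D (k + 1) - D k) * g k - D n * g n) +
          D (n + 1) * (g n - g (n + 1)) := by ring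
      rw [e]
      refine (abs_add_le _ _).trans ?_
      linarith
  have h2 : |D N * g N| ≤ s * g N := by
    rw [abs_mul, abs_of_nonneg (h0 N hMN)]
    exact mul_le_mul_of_nonneg_right (hD N hMN) (h0 N hMN)
  have := abs_sub_abs_le_abs_sub (∑ k ∈ Finset.Ico M N, (D (k + 1) - D k) * g k) (D N * g N)
  linarith

open Topology in
/-- A signed prime weight whose sums against `-log (1 - 1 / p)` are `o(1 / log)` has
weighted Chebyshev function `o(N)`. -/
theorem tendsto_sum_mul_log_div {δ : ℕ → ℝ} (hδ : ∀ k, |δ k| ≤ 1)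
    (hD : Tendsto (fun m : ℕ => (∑ k ∈ Finset.range m, δ k * primeWeight k) * log m)
      atTop (𝓝 0)) :
    Tendsto (fun N : ℕ => (∑ k ∈ Finset.range N, δ k * if k.Prime then log k else 0) / (N : ℝ))
      atTop (𝓝 0) := by
  set D : ℕ → ℝ := fun m => ∑ k ∈ Finset.range m, δ k * primeWeight k with hDdef
  have hDs : ∀ k, D (k + 1) - D k = δ k * primeWeight k := fun k => by
    simp [hDdef, Finset.sum_range_succ]
  set W : ℕ → ℝ := fun k => -log (1 - 1 / (k : ℝ)) with hW
  have hWge : ∀ k : ℕ, 2 ≤ k → 1 / (k : ℝ) ≤ W k := by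
    intro k hk
    have : (2 : ℝ) ≤ k := by exact_mod_cast hk
    have h1 : 1 / (k : ℝ) ≤ 1 / 2 := by gcongr
    have := Real.log_le_sub_one_of_pos (x := 1 - 1 / (k : ℝ)) (by linarith)
    simp only [hW]
    linarith
  have hWpos : ∀ k : ℕ, 2 ≤ k → 0 < W k := fun k hk =>
    lt_of_lt_of_le (by have : (0 : ℝ) < k := by exact_mod_cast (by omega : 0 < k)
                       positivity) (hWge k hk)
  have hWanti : ∀ k : ℕ, 2 ≤ k → W (k + 1) ≤ W k := by
    intro k hk
    have : (2 : ℝ) ≤ k := by exact_mod_cast hk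
    have h1 : 1 / (k : ℝ) ≤ 1 / 2 := by gcongr
    simp only [hW]
    apply neg_le_neg
    apply Real.log_le_log (by linarith)
    gcongr
    linarith
  set g : ℕ → ℝ := fun k => log k / W k with hg
  have hgmono : ∀ k : ℕ, 2 ≤ k → g k ≤ g (k + 1) := by
    intro k hk
    have h0 : (0 : ℝ) < k := by exact_mod_cast (by omega : 0 < k)
    simp only [hg]
    apply div_le_div₀ (Real.log_natCast_nonneg _) _ (hWpos _ (by omega)) (hWanti k hk)
    apply Real.log_le_log h0
    push_cast; linarith
  have hgle : ∀ k : ℕ, 2 ≤ k → g k ≤ k * log k := by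
    intro k hk
    have h0 : (0 : ℝ) < k := by exact_mod_cast (by omega : 0 < k)
    simp only [hg]
    rw [div_le_iff₀ (hWpos k hk)]
    have h1 := hWge k hk
    calc log k = k * log k * (1 / k) := by field_simp
      _ ≤ _ := by
        have := Real.log_natCast_nonneg k
        gcongr
  have hg0 : ∀ k : ℕ, 2 ≤ k → 0 ≤ g k := fun k hk =>
    div_nonneg (Real.log_natCast_nonneg _) (hWpos k hk).le
  have hterm : ∀ k : ℕ, 2 ≤ k →
      δ k * (if k.Prime then log k else 0) = (D (k + 1) - D k) * g k := by
    intro k hk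
    rw [hDs, primeWeight]
    split_ifs
    · have := (hWpos k hk).ne'
      simp only [hg]
      change _ = δ k * W k * _
      field_simp
    · simp
  have hlogdiv : Tendsto (fun M : ℕ => log M / (M : ℝ)) atTop (𝓝 0) := by
    have := (Real.isLittleO_log_id_atTop.tendsto_div_nhds_zero).comp
      (tendsto_natCast_atTop_atTop (R := ℝ))
    exact this
  rw [Metric.tendsto_atTop]
  intro ε hε
  have hε' : 0 < ε / 10 := by linarith
  obtain ⟨M₀, hM₀⟩ := Metric.tendsto_atTop.1 hD (ε / 10) hε'
  obtain ⟨M₁, hM₁⟩ := Metric.tendsto_atTop.1 hlogdiv (ε / 10) hε'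
  refine ⟨(max (max M₀ M₁) 2) ^ 2, fun N hN => ?_⟩
  set M := Nat.sqrt N with hM
  have hMge : max (max M₀ M₁) 2 ≤ M := by
    rw [hM, Nat.le_sqrt']; exact hN
  have hM2 : 2 ≤ M := le_trans (le_max_right _ _) hMge
  have hMM0 : M₀ ≤ M := le_trans (le_trans (le_max_left _ _) (le_max_left _ _)) hMge
  have hMM1 : M₁ ≤ M := le_trans (le_trans (le_max_right _ _) (le_max_left _ _)) hMge
  have hMN : M ≤ N := Nat.sqrt_le_self N
  have hMsq : M * M ≤ N := Nat.sqrt_le N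
  have hNlt : N < (M + 1) * (M + 1) := Nat.lt_succ_sqrt N
  have hMr : (2 : ℝ) ≤ M := by exact_mod_cast hM2
  have hNr : (0 : ℝ) < N := by exact_mod_cast (by omega : 0 < N)
  have hlM : 0 < log M := Real.log_pos (by linarith)
  have hlN : log N ≤ 4 * log M := by
    calc log N ≤ log ((M : ℝ) ^ 4) := by
          apply Real.log_le_log hNr
          have h1 : (N : ℝ) ≤ (M + 1) * (M + 1) := by exact_mod_cast hNlt.le
          have h2 : (M : ℝ) + 1 ≤ M * M := by nlinarith
          calc (N : ℝ) ≤ (M + 1) * (M + 1) := h1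
            _ ≤ (M * M) * (M * M) := by gcongr
            _ = _ := by ring
      _ = _ := by rw [Real.log_pow]; norm_num
  have hDs' : ∀ k ≥ M, |D k| ≤ ε / 10 / log M := by
    intro k hk
    have h1 := hM₀ k (by omega)
    rw [Real.dist_eq, sub_zero, abs_mul, abs_of_nonneg (Real.log_natCast_nonneg k)] at h1
    rw [le_div_iff₀ hlM]
    refine le_trans ?_ h1.le
    have : (M : ℝ) ≤ k := by exact_mod_cast hk
    gcongr
  have hB := abs_sum_sub_mul_le_of_monotone hMN hDs' (fun k hk => hgmono k (by omega)) (hg0 M hM2)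
  have hA : |∑ k ∈ Finset.range M, δ k * (if k.Prime then log k else 0)| ≤ M * log M := by
    refine (Finset.abs_sum_le_sum_abs _ _).trans ?_
    calc _ ≤ ∑ _k ∈ Finset.range M, log M := by
          refine Finset.sum_le_sum fun k hk => ?_
          rw [abs_mul]
          have h1 : |if k.Prime then log k else 0| ≤ log M := by
            split_ifs with hp
            · rw [abs_of_nonneg (Real.log_natCast_nonneg k)]
              apply Real.log_le_log (by exact_mod_cast hp.pos)
              exact_mod_cast (Finset.mem_range.1 hk).le
            · simpa using hlM.le
          calc _ ≤ 1 * log M := mul_le_mul (hδ k) h1 (abs_nonneg _) zero_le_one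
            _ = _ := one_mul _
      _ = _ := by simp
  have hsplit : ∑ k ∈ Finset.range N, δ k * (if k.Prime then log k else 0) =
      ∑ k ∈ Finset.range M, δ k * (if k.Prime then log k else 0) +
      ∑ k ∈ Finset.Ico M N, (D (k + 1) - D k) * g k := by
    rw [← Finset.sum_range_add_sum_Ico _ hMN]
    congr 1
    exact Finset.sum_congr rfl fun k hk => hterm k (by have := (Finset.mem_Ico.1 hk).1; omega)
  have hA2 : M * log M ≤ ε / 10 * N := by
    have h1 := hM₁ M hMM1
    rw [Real.dist_eq, sub_zero, abs_of_nonneg (by positivity), div_lt_iff₀ (by linarith)] at h1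
    have h2 : (M : ℝ) * M ≤ N := by exact_mod_cast hMsq
    nlinarith
  have hB2 : 2 * (ε / 10 / log M) * g N ≤ 8 * (ε / 10) * N := by
    calc _ ≤ 2 * (ε / 10 / log M) * (N * (4 * log M)) := by
          have := hgle N (by omega)
          gcongr
          exact this.trans (by gcongr)
      _ = _ := by field_simp; norm_num
  rw [Real.dist_eq, sub_zero, abs_div, abs_of_pos hNr, div_lt_iff₀ hNr, hsplit]
  have := abs_add_le (∑ k ∈ Finset.range M, δ k * (if k.Prime then log k else 0))
    (∑ k ∈ Finset.Ico M N, (D (k + 1) - D k) * g k)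
  nlinarith

theorem neg_log_one_sub_bounds {t : ℝ} (h0 : 0 ≤ t) (h1 : t ≤ 1 / 2) :
    t ≤ -log (1 - t) ∧ -log (1 - t) ≤ t + 2 * t ^ 2 := by
  constructor
  · have := Real.log_le_sub_one_of_pos (x := 1 - t) (by linarith)
    linarith
  · have := Real.one_sub_inv_le_log_of_pos (x := 1 - t) (by linarith)
    have h2 : (1 - t)⁻¹ ≤ 1 + t + 2 * t ^ 2 := by
      rw [inv_le_iff_one_le_mul₀ (by linarith)]
      nlinarith [mul_nonneg h0 h0, mul_nonneg (mul_nonneg h0 h0) (sub_nonneg.2 h1)]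
    linarith

/-- The logarithm of the Euler factor at a prime, and `0` at other integers. -/
noncomputable def eulerLog (σ : ℝ) (n : ℕ) : ℝ :=
  if n.Prime then -log (1 - (n : ℝ) ^ (-(1 + σ))) else 0

theorem abs_eulerLog_sub_le {σ : ℝ} (hσ : 0 ≤ σ) (n : ℕ) :
    |eulerLog σ n - primeWeight n * (n : ℝ) ^ (-σ)| ≤ 2 * ((n : ℝ) ^ 2)⁻¹ := by
  unfold eulerLog primeWeight
  split_ifs with hp
  · have h2 : (2 : ℝ) ≤ n := by exact_mod_cast hp.two_le
    set x : ℝ := 1 / n with hx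
    set y : ℝ := (n : ℝ) ^ (-σ) with hy
    have e : (n : ℝ) ^ (-(1 + σ)) = x * y := by
      rw [neg_add, Real.rpow_add (by linarith), Real.rpow_neg_one, hx, one_div]
    have hx0 : 0 ≤ x := by positivity
    have hx1 : x ≤ 1 / 2 := by rw [hx]; gcongr
    have hy0 : 0 ≤ y := by positivity
    have hy1 : y ≤ 1 := Real.rpow_le_one_of_one_le_of_nonpos (by linarith) (by linarith)
    have hxy : x * y ≤ x := mul_le_of_le_one_right hx0 hy1
    have b1 := neg_log_one_sub_bounds hx0 hx1
    have b2 := neg_log_one_sub_bounds (mul_nonneg hx0 hy0) (hxy.trans hx1)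
    have e2 : ((n : ℝ) ^ 2)⁻¹ = x ^ 2 := by rw [hx]; simp
    rw [e, e2]
    have c1 : (x * y) ^ 2 ≤ x ^ 2 := by gcongr
    have c2 := mul_le_mul_of_nonneg_right b1.1 hy0
    have c3 := mul_le_mul_of_nonneg_right b1.2 hy0
    have c4 : x ^ 2 * y ≤ x ^ 2 := mul_le_of_le_one_right (by positivity) hy1
    rw [abs_le]
    constructor <;> nlinarith
  · simp

theorem summable_primeWeight_mul_rpow {σ : ℝ} (hσ : 0 < σ) :
    Summable fun n : ℕ => primeWeight n * (n : ℝ) ^ (-σ) := by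
  refine Summable.of_nonneg_of_le
    (fun n => mul_nonneg (primeWeight_nonneg n) (by positivity)) (fun n => ?_)
    ((Real.summable_nat_rpow (p := -(1 + σ)).2 (by linarith)).mul_left 3)
  rcases Nat.eq_zero_or_pos n with rfl | hn
  · simp [primeWeight]
    positivity
  · have hn' : (0 : ℝ) < n := by exact_mod_cast hn
    rw [neg_add, Real.rpow_add hn', Real.rpow_neg_one, ← mul_assoc]
    gcongr
    refine (primeWeight_le n).trans ?_
    rw [div_eq_mul_inv]
    gcongr
    linarith

theorem summable_eulerLog {σ : ℝ} (hσ : 0 < σ) : Summable (eulerLog σ) := by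
  have h1 : Summable fun n : ℕ => eulerLog σ n - primeWeight n * (n : ℝ) ^ (-σ) :=
    Summable.of_norm_bounded ((Real.summable_nat_pow_inv.2 one_lt_two).mul_left 2)
      fun n => abs_eulerLog_sub_le hσ.le n
  simpa using h1.add (summable_primeWeight_mul_rpow hσ)

open Topology in
theorem tendsto_tsum_mul_eulerLog {δ : ℕ → ℝ} (hδ : ∀ k, |δ k| ≤ 1)
    (hD : Tendsto (fun m : ℕ => ∑ k ∈ Finset.range m, δ k * primeWeight k) atTop (𝓝 0)) :
    Tendsto (fun σ : ℝ => ∑' n, δ n * eulerLog σ n) (𝓝[>] 0) (𝓝 0) := by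
  have hbd : ∀ {a : ℕ → ℝ}, Summable a → Summable fun n => δ n * a n := fun {a} ha =>
    Summable.of_norm_bounded ha.norm fun n => by
      rw [norm_mul]; exact mul_le_of_le_one_left (norm_nonneg _) (hδ n)
  have hpow : ∀ n : ℕ, n.Prime → Tendsto (fun σ : ℝ => (n : ℝ) ^ (-σ)) (𝓝[>] 0) (𝓝 1) := by
    intro n hn
    have h0 : (n : ℝ) ≠ 0 := by exact_mod_cast hn.ne_zero
    have : ContinuousAt (fun σ : ℝ => (n : ℝ) ^ (-σ)) 0 :=
      (continuousAt_const.rpow continuousAt_neg (Or.inl h0))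
    have := this.tendsto
    simp only [neg_zero, Real.rpow_zero] at this
    exact this.mono_left nhdsWithin_le_nhds
  have hE : Tendsto (fun σ : ℝ => ∑' n, δ n * (eulerLog σ n - primeWeight n * (n : ℝ) ^ (-σ)))
      (𝓝[>] 0) (𝓝 (∑' _n : ℕ, 0)) := by
    refine tendsto_tsum_of_dominated_convergence
      ((Real.summable_nat_pow_inv.2 one_lt_two).mul_left 2) (fun n => ?_) ?_
    · unfold eulerLog primeWeight
      split_ifs with hp
      · have h2 : (2 : ℝ) ≤ n := by exact_mod_cast hp.two_le
        have h3 : (n : ℝ)⁻¹ ≤ 2⁻¹ := by gcongr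
        have h4 : Tendsto (fun σ : ℝ => (n : ℝ) ^ (-(1 + σ))) (𝓝[>] 0) (𝓝 (n : ℝ)⁻¹) := by
          have := (hpow n hp).const_mul (n : ℝ)⁻¹
          rw [mul_one] at this
          refine this.congr fun σ => ?_
          rw [neg_add, Real.rpow_add (by linarith), Real.rpow_neg_one]
        have h5 := ((h4.const_sub 1).log (by norm_num at h3 ⊢; linarith)).neg
        have h6 := (h5.sub ((hpow n hp).const_mul (-log (1 - 1 / (n : ℝ))))).const_mul (δ n)
        simpa using h6
      · simp
    · filter_upwards [self_mem_nhdsWithin] with σ hσ n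
      rw [norm_mul]
      exact (mul_le_of_le_one_left (norm_nonneg _) (hδ n)).trans
        (abs_eulerLog_sub_le (le_of_lt hσ) n)
  have hW : Tendsto (fun σ : ℝ => ∑' n, δ n * (primeWeight n * (n : ℝ) ^ (-σ)))
      (𝓝[>] 0) (𝓝 0) := by
    set D : ℕ → ℝ := fun m => ∑ k ∈ Finset.range m, δ k * primeWeight k with hDdef
    rw [Metric.tendsto_nhds]
    intro ε hε
    obtain ⟨M₀, hM₀⟩ := Metric.tendsto_atTop.1 hD (ε / 5) (by linarith)
    set M := max M₀ 1 with hM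
    have hDM : ∀ k ≥ M, |D k| ≤ ε / 5 := by
      intro k hk
      have := hM₀ k (le_trans (le_max_left _ _) hk)
      rw [Real.dist_eq, sub_zero] at this
      exact this.le
    have hfin : Tendsto (fun σ : ℝ => ∑ k ∈ Finset.range M,
        δ k * (primeWeight k * (k : ℝ) ^ (-σ))) (𝓝[>] 0) (𝓝 (D M)) := by
      refine tendsto_finsetSum _ fun k _ => ?_
      by_cases hp : k.Prime
      · simpa using ((hpow k hp).const_mul (primeWeight k)).const_mul (δ k)
      · simp [primeWeight, hp]
    filter_upwards [self_mem_nhdsWithin, Metric.tendsto_nhds.1 hfin (ε / 5) (by linarith)]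
      with σ hσ hσ2
    have hσ0 : 0 < σ := hσ
    have hs := (hbd (summable_primeWeight_mul_rpow hσ0)).hasSum.tendsto_sum_nat
    have htail : |∑' n, δ n * (primeWeight n * (n : ℝ) ^ (-σ)) -
        ∑ k ∈ Finset.range M, δ k * (primeWeight k * (k : ℝ) ^ (-σ))| ≤ 2 * (ε / 5) := by
      refine le_of_tendsto (hs.sub_const _).abs ?_
      filter_upwards [eventually_ge_atTop M] with N hN
      have hpos : ∀ k ≥ M, (0 : ℝ) < k := fun k hk => by
        exact_mod_cast lt_of_lt_of_le (by omega : 0 < M) hk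
      rw [← Finset.sum_Ico_eq_sub _ hN]
      have := abs_sum_sub_mul_le_of_antitone (g := fun k : ℕ => (k : ℝ) ^ (-σ)) hN hDM
        (fun k hk => Real.rpow_le_rpow_of_nonpos (hpos k hk) (by push_cast; linarith)
          (by linarith)) (fun k _ => by positivity)
      have e : ∑ k ∈ Finset.Ico M N, δ k * (primeWeight k * (k : ℝ) ^ (-σ)) =
          ∑ k ∈ Finset.Ico M N, (D (k + 1) - D k) * (k : ℝ) ^ (-σ) := by
        refine Finset.sum_congr rfl fun k _ => ?_
        simp only [hDdef, Finset.sum_range_succ]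
        ring
      rw [e]
      refine this.trans ?_
      have h1 : (M : ℝ) ^ (-σ) ≤ 1 := Real.rpow_le_one_of_one_le_of_nonpos
        (by exact_mod_cast le_max_right _ _) (by linarith)
      exact mul_le_of_le_one_right (by linarith) h1
    rw [Real.dist_eq, sub_zero]
    rw [Real.dist_eq] at hσ2
    have h3 := hDM M le_rfl
    rw [abs_le] at htail h3
    rw [abs_lt] at hσ2 ⊢
    constructor <;> linarith
  have := hE.add hW
  simp only [tsum_zero, add_zero] at this
  refine this.congr' ?_
  filter_upwards [self_mem_nhdsWithin] with σ hσ
  have hσ0 : 0 < σ := hσ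
  rw [← Summable.tsum_add (hbd ((summable_eulerLog hσ0).sub (summable_primeWeight_mul_rpow hσ0)))
    (hbd (summable_primeWeight_mul_rpow hσ0))]
  exact tsum_congr fun n => by ring

/-- The positive integers all of whose prime factors lie in `P`. -/
def genBy (P : Set ℕ) : Set ℕ := {n | n ≠ 0 ∧ ∀ p, p.Prime → p ∣ n → p ∈ P}

theorem mul_mem_genBy {P : Set ℕ} {m n : ℕ} : m * n ∈ genBy P ↔ m ∈ genBy P ∧ n ∈ genBy P := by
  constructor
  · rintro ⟨h0, h⟩
    exact ⟨⟨left_ne_zero_of_mul h0, fun p hp hpm => h p hp (hpm.mul_right n)⟩,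
      ⟨right_ne_zero_of_mul h0, fun p hp hpn => h p hp (hpn.mul_left m)⟩⟩
  · rintro ⟨⟨hm0, hm⟩, ⟨hn0, hn⟩⟩
    refine ⟨mul_ne_zero hm0 hn0, fun p hp hpmn => ?_⟩
    rcases hp.dvd_mul.1 hpmn with h | h
    exacts [hm p hp h, hn p hp h]

theorem prime_mem_genBy {P : Set ℕ} {p : ℕ} (hp : p.Prime) : p ∈ genBy P ↔ p ∈ P := by
  constructor
  · rintro ⟨_, h⟩
    exact h p hp dvd_rfl
  · intro h
    refine ⟨hp.ne_zero, fun q hq hqp => ?_⟩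
    rwa [(Nat.prime_dvd_prime_iff_eq hq hp).1 hqp]

theorem one_mem_genBy (P : Set ℕ) : 1 ∈ genBy P :=
  ⟨one_ne_zero, fun _ hp h => absurd (Nat.dvd_one.1 h) hp.ne_one⟩

open Classical in
theorem tsum_genBy_rpow (P : Set ℕ) {σ : ℝ} (hσ : 0 < σ) :
    Summable (fun n : ℕ => (if n ∈ genBy P then 1 else 0) * (n : ℝ) ^ (-(1 + σ))) ∧
    ∑' n : ℕ, (if n ∈ genBy P then 1 else 0) * (n : ℝ) ^ (-(1 + σ)) =
      exp (∑' n, (if n ∈ P then 1 else 0) * eulerLog σ n) := by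
  let f : ℕ →*₀ ℝ :=
    { toFun := fun n => (if n ∈ genBy P then 1 else 0) * (n : ℝ) ^ (-(1 + σ))
      map_zero' := by simp [genBy]
      map_one' := by simp [one_mem_genBy]
      map_mul' := fun m n => by
        push_cast
        rw [Real.mul_rpow (by positivity) (by positivity)]
        by_cases hm : m ∈ genBy P <;> by_cases hn : n ∈ genBy P <;>
          simp [hm, hn, mul_mem_genBy] }
  have hf : ∀ n, f n = (if n ∈ genBy P then 1 else 0) * (n : ℝ) ^ (-(1 + σ)) := fun _ => rfl
  have hsum : Summable fun n => ‖f n‖ := by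
    refine Summable.of_nonneg_of_le (fun _ => norm_nonneg _) (fun n => ?_)
      (Real.summable_nat_rpow (p := -(1 + σ)).2 (by linarith))
    rw [hf, norm_mul, Real.norm_of_nonneg (by positivity : (0 : ℝ) ≤ (n : ℝ) ^ (-(1 + σ)))]
    refine mul_le_of_le_one_left (by positivity) ?_
    split_ifs <;> simp
  refine ⟨hsum.of_norm, ?_⟩
  have h1 := EulerProduct.eulerProduct_completely_multiplicative hsum
  have hP : Summable fun n => (if n ∈ P then (1 : ℝ) else 0) * eulerLog σ n :=
    Summable.of_norm_bounded (summable_eulerLog hσ).norm fun n => by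
      rw [norm_mul]
      refine mul_le_of_le_one_left (norm_nonneg _) ?_
      split_ifs <;> simp
  have h2 := (Real.continuous_exp.tendsto _).comp hP.hasSum.tendsto_sum_nat
  refine tendsto_nhds_unique h1 (h2.congr fun n => ?_)
  rw [Function.comp_apply, Real.exp_sum, Nat.primesBelow, Finset.prod_filter]
  refine Finset.prod_congr rfl fun p _ => ?_
  by_cases hp : p.Prime
  · have h3 : (2 : ℝ) ≤ p := by exact_mod_cast hp.two_le
    have h4 : (p : ℝ) ^ (-(1 + σ)) < 1 :=
      Real.rpow_lt_one_of_one_lt_of_neg (by linarith) (by linarith)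
    rw [if_pos hp, hf, eulerLog, if_pos hp]
    by_cases hp' : p ∈ P
    · rw [if_pos hp', if_pos ((prime_mem_genBy hp).2 hp'), one_mul, one_mul, Real.exp_neg,
        Real.exp_log (by linarith)]
    · rw [if_neg hp', if_neg (mt (prime_mem_genBy hp).1 hp')]
      simp
  · simp [eulerLog, hp]

open Classical Topology in
theorem tendsto_rpow_mul_tsum_genBy {P : Set ℕ} {z : ℝ} (hz0 : 0 ≤ z) (hz1 : z ≤ 1)
    (hD : Tendsto (fun m : ℕ => ∑ k ∈ Finset.range m,
      ((if k ∈ P then 1 else 0) - z) * primeWeight k) atTop (𝓝 0)) :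
    Tendsto (fun σ : ℝ => σ ^ z * ∑' n : ℕ, (if n ∈ genBy P then 1 else 0) *
      (n : ℝ) ^ (-(1 + σ))) (𝓝[>] 0) (𝓝 1) := by
  have h1 := tendsto_tsum_mul_eulerLog (fun k => by
    split_ifs <;> rw [abs_le] <;> constructor <;> linarith) hD
  have h2 : Tendsto (fun σ : ℝ => σ * ∑' n : ℕ, (n : ℝ) ^ (-(1 + σ))) (𝓝[>] 0) (𝓝 1) := by
    have hmap : Tendsto (fun σ : ℝ => 1 + σ) (𝓝[>] 0) (𝓝[>] 1) := by
      refine tendsto_nhdsWithin_iff.2 ⟨?_, ?_⟩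
      · have : ContinuousAt (fun σ : ℝ => 1 + σ) 0 := by fun_prop
        have := this.tendsto
        simp only [add_zero] at this
        exact this.mono_left nhdsWithin_le_nhds
      · filter_upwards [self_mem_nhdsWithin] with σ hσ
        have : 0 < σ := hσ
        simpa using this
    refine (tendsto_sub_mul_tsum_nat_rpow.comp hmap).congr fun σ => ?_
    simp only [Function.comp_apply, add_sub_cancel_left]
    congr 1
    exact tsum_congr fun n => by rw [Real.rpow_neg (by positivity), one_div]
  have h3 := (h2.rpow_const (p := z) (Or.inl one_ne_zero)).mul
    ((Real.continuous_exp.tendsto 0).comp h1)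
  rw [Real.one_rpow, Real.exp_zero, mul_one] at h3
  refine h3.congr' ?_
  filter_upwards [self_mem_nhdsWithin] with σ hσ
  have hσ0 : 0 < σ := hσ
  have e1 := (tsum_genBy_rpow Set.univ hσ0).2
  have e0 : ∑' n : ℕ, (if n ∈ genBy Set.univ then 1 else 0) * (n : ℝ) ^ (-(1 + σ)) =
      ∑' n : ℕ, (n : ℝ) ^ (-(1 + σ)) := by
    refine tsum_congr fun n => ?_
    rcases Nat.eq_zero_or_pos n with rfl | hn
    · rw [Nat.cast_zero, Real.zero_rpow (by linarith), mul_zero]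
    · simp [genBy, hn.ne']
  simp only [e0, Set.mem_univ, if_true, one_mul] at e1
  have hs := summable_eulerLog hσ0
  have hP : Summable fun n => (if n ∈ P then (1 : ℝ) else 0) * eulerLog σ n :=
    Summable.of_norm_bounded hs.norm fun n => by
      rw [norm_mul]
      refine mul_le_of_le_one_left (norm_nonneg _) ?_
      split_ifs <;> simp
  have e3 : ∑' n, ((if n ∈ P then 1 else 0) - z) * eulerLog σ n =
      ∑' n, (if n ∈ P then 1 else 0) * eulerLog σ n - z * ∑' n, eulerLog σ n := by
    rw [← tsum_mul_left, ← hP.tsum_sub (hs.mul_left z)]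
    exact tsum_congr fun n => by ring
  rw [Function.comp_apply, e3, e1, (tsum_genBy_rpow P hσ0).2,
    Real.mul_rpow hσ0.le (Real.exp_pos _).le, ← Real.exp_mul, mul_assoc, ← Real.exp_add]
  congr 2
  ring

theorem natCast_rpow_neg_mem_Icc {σ : ℝ} (hσ : 0 < σ) (n : ℕ) :
    (n : ℝ) ^ (-σ) ∈ Set.Icc (0 : ℝ) 1 := by
  refine ⟨by positivity, ?_⟩
  rcases Nat.eq_zero_or_pos n with rfl | hn
  · rw [Nat.cast_zero, Real.zero_rpow (by linarith)]
    exact zero_le_one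
  · exact Real.rpow_le_one_of_one_le_of_nonpos (by exact_mod_cast hn) (by linarith)

theorem summable_mul_comp_rpow {b : ℕ → ℝ} {σ : ℝ} (hσ : 0 < σ)
    (hb : Summable fun n : ℕ => b n * (n : ℝ) ^ (-σ)) {g : ℝ → ℝ} (hg : Continuous g) :
    Summable fun n : ℕ => b n * (n : ℝ) ^ (-σ) * g ((n : ℝ) ^ (-σ)) := by
  obtain ⟨C, hC⟩ := isCompact_Icc.exists_bound_of_continuousOn (hg.continuousOn (s := Set.Icc 0 1))
  refine Summable.of_norm_bounded (hb.norm.mul_right C) fun n => ?_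
  rw [norm_mul]
  gcongr
  exact hC _ (natCast_rpow_neg_mem_Icc hσ n)

theorem exp_neg_mem_Icc {u : ℝ} (hu : u ∈ Set.Ioi (0 : ℝ)) : exp (-u) ∈ Set.Icc (0 : ℝ) 1 :=
  ⟨(exp_pos _).le, Real.exp_le_one_iff.2 (by have : 0 < u := hu; linarith)⟩

open MeasureTheory in
theorem integrableOn_gamma_mul_comp_exp {z : ℝ} (hz : 0 < z) {g : ℝ → ℝ} (hg : Continuous g) :
    IntegrableOn (fun u => exp (-u) * u ^ (z - 1) * g (exp (-u))) (Set.Ioi 0) := by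
  obtain ⟨C, hC⟩ := isCompact_Icc.exists_bound_of_continuousOn (hg.continuousOn (s := Set.Icc 0 1))
  refine (Real.GammaIntegral_convergent hz).mul_bdd (c := C) ?_ ?_
  · exact (hg.comp (Real.continuous_exp.comp continuous_neg)).aestronglyMeasurable
  · filter_upwards [ae_restrict_mem measurableSet_Ioi] with u hu
    exact hC _ (exp_neg_mem_Icc hu)

open Topology in
theorem tendsto_tsum_mul_polynomial {b : ℕ → ℝ} {z : ℝ} (hz : 0 < z) (hb0 : b 0 = 0)
    (hb : ∀ σ : ℝ, 0 < σ → Summable fun n : ℕ => b n * (n : ℝ) ^ (-σ))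
    (hlim : Tendsto (fun σ : ℝ => σ ^ z * ∑' n : ℕ, b n * (n : ℝ) ^ (-σ)) (𝓝[>] 0) (𝓝 1))
    (p : Polynomial ℝ) :
    Tendsto (fun σ : ℝ => σ ^ z * ∑' n : ℕ, b n * (n : ℝ) ^ (-σ) * p.eval ((n : ℝ) ^ (-σ)))
      (𝓝[>] 0) (𝓝 ((Gamma z)⁻¹ *
        ∫ u in Set.Ioi (0 : ℝ), exp (-u) * u ^ (z - 1) * p.eval (exp (-u)))) := by
  induction p using Polynomial.induction_on' with
  | add p q hp hq =>
    rw [show (∫ u in Set.Ioi (0 : ℝ), exp (-u) * u ^ (z - 1) * (p + q).eval (exp (-u))) =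
      (∫ u in Set.Ioi (0 : ℝ), exp (-u) * u ^ (z - 1) * p.eval (exp (-u))) +
      ∫ u in Set.Ioi (0 : ℝ), exp (-u) * u ^ (z - 1) * q.eval (exp (-u)) by
        rw [← MeasureTheory.integral_add (integrableOn_gamma_mul_comp_exp hz p.continuous)
          (integrableOn_gamma_mul_comp_exp hz q.continuous)]
        simp only [Polynomial.eval_add, mul_add], mul_add]
    refine (hp.add hq).congr' ?_
    filter_upwards [self_mem_nhdsWithin] with σ hσ
    rw [← mul_add, ← (summable_mul_comp_rpow hσ (hb σ hσ) p.continuous).tsum_add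
      (summable_mul_comp_rpow hσ (hb σ hσ) q.continuous)]
    simp only [Polynomial.eval_add, mul_add]
  | monomial k a =>
    have hk : (0 : ℝ) < (k : ℝ) + 1 := by positivity
    have hmap : Tendsto (fun σ : ℝ => σ * ((k : ℝ) + 1)) (𝓝[>] 0) (𝓝[>] 0) := by
      refine tendsto_nhdsWithin_iff.2 ⟨?_, ?_⟩
      · have : ContinuousAt (fun σ : ℝ => σ * ((k : ℝ) + 1)) 0 := by fun_prop
        have := this.tendsto
        simp only [zero_mul] at this
        exact this.mono_left nhdsWithin_le_nhds
      · filter_upwards [self_mem_nhdsWithin] with σ hσ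
        exact mul_pos hσ hk
    have h1 := (hlim.comp hmap).const_mul (a * (1 / ((k : ℝ) + 1)) ^ z)
    have hInt : (Gamma z)⁻¹ * ∫ u in Set.Ioi (0 : ℝ), exp (-u) * u ^ (z - 1) *
        (Polynomial.monomial k a).eval (exp (-u)) = a * (1 / ((k : ℝ) + 1)) ^ z * 1 := by
      have h2 := Real.integral_rpow_mul_exp_neg_mul_Ioi hz hk
      have h3 : ∀ u : ℝ, exp (-u) * u ^ (z - 1) * (Polynomial.monomial k a).eval (exp (-u)) =
          a * (u ^ (z - 1) * exp (-(((k : ℝ) + 1) * u))) := by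
        intro u
        rw [Polynomial.eval_monomial, ← Real.exp_nat_mul,
          show -(((k : ℝ) + 1) * u) = -u + k * -u by ring, Real.exp_add]
        ring
      simp_rw [h3]
      rw [MeasureTheory.integral_const_mul, h2]
      have := (Real.Gamma_pos_of_pos hz).ne'
      field_simp
    rw [hInt]
    refine h1.congr' ?_
    filter_upwards [self_mem_nhdsWithin] with σ hσ
    have hσ0 : 0 < σ := hσ
    have h4 : ∑' n : ℕ, b n * (n : ℝ) ^ (-σ) * (Polynomial.monomial k a).eval ((n : ℝ) ^ (-σ)) =
        a * ∑' n : ℕ, b n * (n : ℝ) ^ (-(σ * ((k : ℝ) + 1))) := by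
      rw [← tsum_mul_left]
      refine tsum_congr fun n => ?_
      rcases Nat.eq_zero_or_pos n with rfl | hn
      · simp [hb0]
      · have hn' : (0 : ℝ) < n := by exact_mod_cast hn
        rw [Polynomial.eval_monomial, ← Real.rpow_natCast, ← Real.rpow_mul hn'.le,
          show -(σ * ((k : ℝ) + 1)) = -σ + -σ * k by ring, Real.rpow_add hn']
        ring
    rw [h4, Function.comp_apply, Real.mul_rpow hσ0.le hk.le, one_div, Real.inv_rpow hk.le]
    have : ((k : ℝ) + 1) ^ z ≠ 0 := (Real.rpow_pos_of_pos hk z).ne'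
    field_simp

open Topology in
theorem tendsto_tsum_mul_continuous {b : ℕ → ℝ} {z : ℝ} (hz : 0 < z) (hb0 : b 0 = 0)
    (hbn : ∀ n, 0 ≤ b n)
    (hb : ∀ σ : ℝ, 0 < σ → Summable fun n : ℕ => b n * (n : ℝ) ^ (-σ))
    (hlim : Tendsto (fun σ : ℝ => σ ^ z * ∑' n : ℕ, b n * (n : ℝ) ^ (-σ)) (𝓝[>] 0) (𝓝 1))
    {g : ℝ → ℝ} (hg : Continuous g) :
    Tendsto (fun σ : ℝ => σ ^ z * ∑' n : ℕ, b n * (n : ℝ) ^ (-σ) * g ((n : ℝ) ^ (-σ)))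
      (𝓝[>] 0) (𝓝 ((Gamma z)⁻¹ *
        ∫ u in Set.Ioi (0 : ℝ), exp (-u) * u ^ (z - 1) * g (exp (-u)))) := by
  have hΓ := Real.Gamma_pos_of_pos hz
  rw [Metric.tendsto_nhds]
  intro ε hε
  obtain ⟨p, hp⟩ := exists_polynomial_near_of_continuousOn 0 1 g hg.continuousOn (ε / 5)
    (by linarith)
  have hI : |(Gamma z)⁻¹ * (∫ u in Set.Ioi (0 : ℝ), exp (-u) * u ^ (z - 1) * p.eval (exp (-u))) -
      (Gamma z)⁻¹ * ∫ u in Set.Ioi (0 : ℝ), exp (-u) * u ^ (z - 1) * g (exp (-u))| ≤ ε / 5 := by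
    rw [← mul_sub, abs_mul, abs_of_pos (inv_pos.2 hΓ), inv_mul_le_iff₀ hΓ,
      ← MeasureTheory.integral_sub (integrableOn_gamma_mul_comp_exp hz p.continuous)
        (integrableOn_gamma_mul_comp_exp hz hg), Real.Gamma_eq_integral hz,
      ← MeasureTheory.integral_mul_const, ← Real.norm_eq_abs]
    refine MeasureTheory.norm_integral_le_of_norm_le
      ((Real.GammaIntegral_convergent hz).mul_const _) ?_
    filter_upwards [MeasureTheory.ae_restrict_mem measurableSet_Ioi] with u hu
    have hu0 : 0 < u := hu
    rw [← mul_sub, norm_mul, Real.norm_of_nonneg (by positivity)]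
    gcongr
    exact (hp _ (exp_neg_mem_Icc hu)).le
  filter_upwards [self_mem_nhdsWithin,
    Metric.tendsto_nhds.1 (tendsto_tsum_mul_polynomial hz hb0 hb hlim p) (ε / 5) (by linarith),
    hlim.eventually (gt_mem_nhds one_lt_two)] with σ hσ h1 h2
  have hσ0 : 0 < σ := hσ
  have h3 : |σ ^ z * ∑' n : ℕ, b n * (n : ℝ) ^ (-σ) * g ((n : ℝ) ^ (-σ)) -
      σ ^ z * ∑' n : ℕ, b n * (n : ℝ) ^ (-σ) * p.eval ((n : ℝ) ^ (-σ))| ≤ 2 * (ε / 5) := by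
    have hz0 : 0 ≤ σ ^ z := by positivity
    rw [← mul_sub, ← (summable_mul_comp_rpow hσ (hb σ hσ) hg).tsum_sub
      (summable_mul_comp_rpow hσ (hb σ hσ) p.continuous), abs_mul, abs_of_nonneg hz0]
    have h4 : |∑' n : ℕ, (b n * (n : ℝ) ^ (-σ) * g ((n : ℝ) ^ (-σ)) -
        b n * (n : ℝ) ^ (-σ) * p.eval ((n : ℝ) ^ (-σ)))| ≤
        (∑' n : ℕ, b n * (n : ℝ) ^ (-σ)) * (ε / 5) := by
      rw [← tsum_mul_right, ← Real.norm_eq_abs]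
      refine tsum_of_norm_bounded ((hb σ hσ).mul_right _).hasSum fun n => ?_
      have h5 : 0 ≤ b n * (n : ℝ) ^ (-σ) := mul_nonneg (hbn n) (by positivity)
      rw [← mul_sub, norm_mul, Real.norm_of_nonneg h5, norm_sub_rev]
      gcongr
      exact (hp _ (natCast_rpow_neg_mem_Icc hσ0 n)).le
    calc _ ≤ σ ^ z * ((∑' n : ℕ, b n * (n : ℝ) ^ (-σ)) * (ε / 5)) := by gcongr
      _ = (σ ^ z * ∑' n : ℕ, b n * (n : ℝ) ^ (-σ)) * (ε / 5) := by ring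
      _ ≤ _ := by gcongr
  rw [Real.dist_eq] at h1 ⊢
  rw [abs_lt] at h1 ⊢
  rw [abs_le] at h3 hI
  constructor <;> linarith

/-- The continuous cutoff equal to `1` up to `a`, to `0` from `a + d` on, and linear between. -/
noncomputable def cutoff (a d u : ℝ) : ℝ := max 0 (min 1 ((a + d - u) / d))

theorem continuous_cutoff (a d : ℝ) : Continuous (cutoff a d) := by
  unfold cutoff
  fun_prop

theorem cutoff_nonneg (a d u : ℝ) : 0 ≤ cutoff a d u := le_max_left _ _

theorem cutoff_le_one (a d u : ℝ) : cutoff a d u ≤ 1 :=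
  max_le zero_le_one (min_le_left _ _)

theorem cutoff_eq_one {a d u : ℝ} (hd : 0 < d) (hu : u ≤ a) : cutoff a d u = 1 := by
  have : 1 ≤ (a + d - u) / d := by rw [le_div_iff₀ hd]; linarith
  rw [cutoff, min_eq_left this, max_eq_right zero_le_one]

theorem cutoff_eq_zero {a d u : ℝ} (hd : 0 < d) (hu : a + d ≤ u) : cutoff a d u = 0 := by
  have : (a + d - u) / d ≤ 0 := div_nonpos_of_nonpos_of_nonneg (by linarith) hd.le
  rw [cutoff, max_eq_left ((min_le_right _ _).trans this)]

open Topology in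
theorem tendsto_tsum_mul_cutoff {b : ℕ → ℝ} {z : ℝ} (hz : 0 < z) (hb0 : b 0 = 0)
    (hbn : ∀ n, 0 ≤ b n)
    (hb : ∀ σ : ℝ, 0 < σ → Summable fun n : ℕ => b n * (n : ℝ) ^ (-σ))
    (hlim : Tendsto (fun σ : ℝ => σ ^ z * ∑' n : ℕ, b n * (n : ℝ) ^ (-σ)) (𝓝[>] 0) (𝓝 1))
    {a d : ℝ} (hd : 0 < d) (had : a + d ≤ 3) :
    Tendsto (fun σ : ℝ => σ ^ z * ∑' n : ℕ, b n * cutoff a d (σ * log n))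
      (𝓝[>] 0) (𝓝 ((Gamma z)⁻¹ * ∫ u in Set.Ioi (0 : ℝ), u ^ (z - 1) * cutoff a d u)) := by
  set g : ℝ → ℝ := fun x => (max x (exp (-3)))⁻¹ * cutoff a d (-log (max x (exp (-3)))) with hg
  have hmax : ∀ x : ℝ, max x (exp (-3)) ≠ 0 := fun x =>
    ((exp_pos _).trans_le (le_max_right _ _)).ne'
  have hmc : Continuous fun x : ℝ => max x (exp (-3)) := by fun_prop
  have hgc : Continuous g :=
    (hmc.inv₀ hmax).mul ((continuous_cutoff a d).comp (hmc.log hmax).neg)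
  have key : ∀ u : ℝ, exp (-u) * g (exp (-u)) = cutoff a d u := by
    intro u
    simp only [hg]
    rcases le_total u 3 with h | h
    · rw [max_eq_left (Real.exp_le_exp.2 (by linarith)), Real.log_exp, neg_neg, ← mul_assoc,
        mul_inv_cancel₀ (exp_pos _).ne', one_mul]
    · rw [max_eq_right (Real.exp_le_exp.2 (by linarith)), Real.log_exp, neg_neg,
        cutoff_eq_zero hd had, cutoff_eq_zero hd (had.trans h), mul_zero, mul_zero]
  have h1 := tendsto_tsum_mul_continuous hz hb0 hbn hb hlim hgc
  have e1 : ∀ u : ℝ, exp (-u) * u ^ (z - 1) * g (exp (-u)) = u ^ (z - 1) * cutoff a d u := by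
    intro u
    rw [← key]; ring
  simp_rw [e1] at h1
  refine h1.congr fun σ => ?_
  congr 1
  refine tsum_congr fun n => ?_
  rcases Nat.eq_zero_or_pos n with rfl | hn
  · simp [hb0]
  · have hn' : (0 : ℝ) < n := by exact_mod_cast hn
    rw [← key, Real.rpow_def_of_pos hn', show log n * -σ = -(σ * log n) by ring]
    ring

open MeasureTheory in
theorem integral_mul_cutoff_bounds {z : ℝ} (hz : 0 < z) {a d : ℝ} (ha : 0 ≤ a) (hd : 0 < d) :
    a ^ z / z ≤ ∫ u in Set.Ioi (0 : ℝ), u ^ (z - 1) * cutoff a d u ∧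
    ∫ u in Set.Ioi (0 : ℝ), u ^ (z - 1) * cutoff a d u ≤ (a + d) ^ z / z := by
  have hInt : ∀ c : ℝ, 0 ≤ c → ∫ u in Set.Ioc (0 : ℝ) c, u ^ (z - 1) = c ^ z / z := by
    intro c hc
    rw [← intervalIntegral.integral_of_le hc, integral_rpow (Or.inl (by linarith)),
      sub_add_cancel, Real.zero_rpow hz.ne', sub_zero]
  have hon : ∀ c : ℝ, 0 ≤ c → IntegrableOn (fun u : ℝ => u ^ (z - 1)) (Set.Ioc 0 c) := by
    intro c hc
    exact (intervalIntegrable_iff_integrableOn_Ioc_of_le hc).1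
      (intervalIntegral.intervalIntegrable_rpow' (by linarith))
  have hcut : IntegrableOn (fun u : ℝ => u ^ (z - 1) * cutoff a d u) (Set.Ioc 0 (a + d)) := by
    refine (hon _ (by linarith)).mul_bdd (c := 1)
      (continuous_cutoff a d).aestronglyMeasurable (ae_of_all _ fun u => ?_)
    rw [Real.norm_of_nonneg (cutoff_nonneg a d u)]
    exact cutoff_le_one a d u
  have heq : ∫ u in Set.Ioi (0 : ℝ), u ^ (z - 1) * cutoff a d u =
      ∫ u in Set.Ioc (0 : ℝ) (a + d), u ^ (z - 1) * cutoff a d u := by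
    refine (setIntegral_eq_of_subset_of_forall_sdiff_eq_zero measurableSet_Ioi
      Set.Ioc_subset_Ioi_self fun u hu => ?_)
    have : a + d < u := by
      by_contra! h
      exact hu.2 ⟨hu.1, h⟩
    rw [cutoff_eq_zero hd this.le, mul_zero]
  rw [heq, ← hInt a ha, ← hInt (a + d) (by linarith)]
  constructor
  · calc ∫ u in Set.Ioc (0 : ℝ) a, u ^ (z - 1) =
        ∫ u in Set.Ioc (0 : ℝ) a, u ^ (z - 1) * cutoff a d u := by
          refine setIntegral_congr_fun measurableSet_Ioc fun u hu => ?_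
          simp only [cutoff_eq_one hd hu.2, mul_one]
      _ ≤ _ := by
          refine setIntegral_mono_set hcut ?_ ?_
          · filter_upwards [ae_restrict_mem measurableSet_Ioc] with u hu
            exact mul_nonneg (Real.rpow_nonneg hu.1.le _) (cutoff_nonneg _ _ _)
          · exact (Set.Ioc_subset_Ioc_right (by linarith)).eventuallyLE
  · refine setIntegral_mono_on hcut (hon _ (by linarith)) measurableSet_Ioc fun u hu => ?_
    exact mul_le_of_le_one_right (Real.rpow_nonneg hu.1.le _) (cutoff_le_one _ _ _)

open Topology in
/-- The Karamata Tauberian theorem. -/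
theorem tendsto_sum_div_log_rpow {b : ℕ → ℝ} {z : ℝ} (hz : 0 < z) (hb0 : b 0 = 0)
    (hbn : ∀ n, 0 ≤ b n)
    (hb : ∀ σ : ℝ, 0 < σ → Summable fun n : ℕ => b n * (n : ℝ) ^ (-σ))
    (hlim : Tendsto (fun σ : ℝ => σ ^ z * ∑' n : ℕ, b n * (n : ℝ) ^ (-σ)) (𝓝[>] 0) (𝓝 1)) :
    Tendsto (fun x : ℝ => (∑ n ∈ Finset.range (⌊x⌋₊ + 1), b n) / log x ^ z) atTop
      (𝓝 (Gamma (z + 1))⁻¹) := by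
  have hΓ := Real.Gamma_pos_of_pos hz
  have hσ : Tendsto (fun x : ℝ => (log x)⁻¹) atTop (𝓝[>] 0) :=
    tendsto_inv_atTop_nhdsGT_zero.comp Real.tendsto_log_atTop
  have hmem : ∀ x : ℝ, 1 < x → ∀ n : ℕ, 1 ≤ n → (n ∈ Finset.range (⌊x⌋₊ + 1) ↔
      (log x)⁻¹ * log n ≤ 1) := by
    intro x hx n hn
    have hn' : (0 : ℝ) < n := by exact_mod_cast hn
    rw [inv_mul_le_iff₀ (Real.log_pos hx), mul_one, Real.log_le_log_iff hn' (by linarith),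
      Finset.mem_range, Nat.lt_succ_iff, Nat.le_floor_iff (by linarith)]
  have e : (Gamma (z + 1))⁻¹ = (Gamma z)⁻¹ * (1 ^ z / z) := by
    rw [Real.Gamma_add_one hz.ne', Real.one_rpow, mul_inv]; ring
  have hpow : ∀ x : ℝ, 1 < x → ∀ S : ℝ, (log x)⁻¹ ^ z * S = S / log x ^ z := by
    intro x hx S
    rw [Real.inv_rpow (Real.log_pos hx).le]; ring
  rw [e]
  refine tendsto_order.2 ⟨fun c hc => ?_, fun c hc => ?_⟩
  · have hcont : Tendsto (fun d : ℝ => (Gamma z)⁻¹ * ((1 - d) ^ z / z)) (𝓝[>] 0)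
        (𝓝 ((Gamma z)⁻¹ * (1 ^ z / z))) := by
      have : ContinuousAt (fun d : ℝ => (Gamma z)⁻¹ * ((1 - d) ^ z / z)) 0 := by
        refine continuousAt_const.mul (ContinuousAt.div_const ?_ _)
        exact ContinuousAt.rpow_const (by fun_prop) (Or.inr hz.le)
      have := this.tendsto
      simp only [sub_zero] at this
      exact this.mono_left nhdsWithin_le_nhds
    obtain ⟨d, hd1, hd2⟩ := ((hcont.eventually (lt_mem_nhds hc)).and
      (Ioo_mem_nhdsGT (zero_lt_one' ℝ))).exists
    have h1 := (tendsto_tsum_mul_cutoff hz hb0 hbn hb hlim (a := 1 - d) hd2.1 (by linarith)).comp hσ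
    have h2 := (integral_mul_cutoff_bounds hz (a := 1 - d) (by linarith [hd2.2]) hd2.1).1
    have h3 : c < (Gamma z)⁻¹ * ∫ u in Set.Ioi (0 : ℝ), u ^ (z - 1) * cutoff (1 - d) d u :=
      hd1.trans_le (by gcongr)
    filter_upwards [h1.eventually (lt_mem_nhds h3), eventually_gt_atTop 1] with x hx hx1
    rw [Function.comp_apply, hpow x hx1] at hx
    refine hx.trans_le ?_
    have := Real.log_pos hx1
    gcongr
    rw [tsum_eq_sum (s := Finset.range (⌊x⌋₊ + 1))]
    · exact Finset.sum_le_sum fun n _ => mul_le_of_le_one_right (hbn n) (cutoff_le_one _ _ _)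
    · intro n hn
      rcases Nat.eq_zero_or_pos n with rfl | hn1
      · simp [hb0]
      · rw [hmem x hx1 n hn1, not_le] at hn
        rw [cutoff_eq_zero hd2.1 (by linarith), mul_zero]
  · have hcont : Tendsto (fun d : ℝ => (Gamma z)⁻¹ * ((1 + d) ^ z / z)) (𝓝[>] 0)
        (𝓝 ((Gamma z)⁻¹ * (1 ^ z / z))) := by
      have : ContinuousAt (fun d : ℝ => (Gamma z)⁻¹ * ((1 + d) ^ z / z)) 0 := by
        refine continuousAt_const.mul (ContinuousAt.div_const ?_ _)
        exact ContinuousAt.rpow_const (by fun_prop) (Or.inr hz.le)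
      have := this.tendsto
      simp only [add_zero] at this
      exact this.mono_left nhdsWithin_le_nhds
    obtain ⟨d, hd1, hd2⟩ := ((hcont.eventually (gt_mem_nhds hc)).and
      (Ioo_mem_nhdsGT (zero_lt_one' ℝ))).exists
    have h1 := (tendsto_tsum_mul_cutoff hz hb0 hbn hb hlim (a := 1) hd2.1
      (by linarith [hd2.2])).comp hσ
    have h2 := (integral_mul_cutoff_bounds hz (a := 1) zero_le_one hd2.1).2
    have h3 : (Gamma z)⁻¹ * ∫ u in Set.Ioi (0 : ℝ), u ^ (z - 1) * cutoff 1 d u < c :=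
      lt_of_le_of_lt (by gcongr) hd1
    filter_upwards [h1.eventually (gt_mem_nhds h3), eventually_gt_atTop 1] with x hx hx1
    rw [Function.comp_apply, hpow x hx1] at hx
    refine lt_of_le_of_lt ?_ hx
    have hlx := Real.log_pos hx1
    have hs : Summable fun n : ℕ => b n * cutoff 1 d ((log x)⁻¹ * log n) := by
      refine summable_of_ne_finset_zero (s := Finset.range (⌊x ^ (1 + d)⌋₊ + 1)) fun n hn => ?_
      rcases Nat.eq_zero_or_pos n with rfl | hn1
      · simp [hb0]
      · have h4 : x ^ (1 + d) < n := by
          rw [Finset.mem_range, Nat.lt_succ_iff, not_le] at hn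
          exact Nat.lt_of_floor_lt hn
        have h5 := Real.log_lt_log (by positivity) h4
        rw [Real.log_rpow (by linarith)] at h5
        rw [cutoff_eq_zero hd2.1, mul_zero]
        rw [inv_mul_eq_div, le_div_iff₀ hlx]
        exact h5.le
    gcongr
    calc ∑ n ∈ Finset.range (⌊x⌋₊ + 1), b n =
        ∑ n ∈ Finset.range (⌊x⌋₊ + 1), b n * cutoff 1 d ((log x)⁻¹ * log n) := by
          refine Finset.sum_congr rfl fun n hn => ?_
          rcases Nat.eq_zero_or_pos n with rfl | hn1
          · simp [hb0]
          · rw [cutoff_eq_one hd2.1 ((hmem x hx1 n hn1).1 hn), mul_one]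
      _ ≤ _ := hs.sum_le_tsum _ fun n _ => mul_nonneg (hbn n) (cutoff_nonneg _ _ _)

open Classical Topology in
theorem tendsto_sum_genBy_div {P : Set ℕ} {z : ℝ} (hz0 : 0 < z) (hz1 : z ≤ 1)
    (hD : Tendsto (fun m : ℕ => ∑ k ∈ Finset.range m,
      ((if k ∈ P then 1 else 0) - z) * primeWeight k) atTop (𝓝 0)) :
    Tendsto (fun x : ℝ => (∑ n ∈ Finset.range (⌊x⌋₊ + 1),
      (if n ∈ genBy P then 1 else 0) / (n : ℝ)) / log x ^ z) atTop (𝓝 (Gamma (z + 1))⁻¹) := by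
  have e : ∀ σ : ℝ, 0 < σ → ∀ n : ℕ, (if n ∈ genBy P then 1 else 0) / (n : ℝ) * (n : ℝ) ^ (-σ) =
      (if n ∈ genBy P then 1 else 0) * (n : ℝ) ^ (-(1 + σ)) := by
    intro σ hσ n
    rcases Nat.eq_zero_or_pos n with rfl | hn
    · simp [genBy]
    · rw [neg_add, Real.rpow_add (by exact_mod_cast hn), Real.rpow_neg_one]
      ring
  refine tendsto_sum_div_log_rpow hz0 (by simp) (fun n => ?_) (fun σ hσ => ?_) ?_
  · split_ifs <;> positivity
  · simp_rw [e σ hσ]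
    exact (tsum_genBy_rpow P hσ).1
  · refine (tendsto_rpow_mul_tsum_genBy hz0.le hz1 hD).congr' ?_
    filter_upwards [self_mem_nhdsWithin] with σ hσ
    simp_rw [e σ hσ]

open Classical Topology in
theorem tendsto_sum_vonMangoldt_genBy_div {P : Set ℕ} {z : ℝ}
    (hL : Tendsto (fun N : ℕ => (∑ k ∈ Finset.range N, ((if k ∈ P then 1 else 0) - z) *
      if k.Prime then log k else 0) / (N : ℝ)) atTop (𝓝 0)) :
    Tendsto (fun N : ℕ => (∑ n ∈ Finset.Ioc 0 N, (if n ∈ genBy P then 1 else 0) *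
      ArithmeticFunction.vonMangoldt n) / (N : ℝ)) atTop (𝓝 z) := by
  have hcast := tendsto_natCast_atTop_atTop (R := ℝ)
  have h1 : Tendsto (fun N : ℕ => (∑ k ∈ Finset.range (N + 1), ((if k ∈ P then 1 else 0) - z) *
      if k.Prime then log k else 0) / (N : ℝ)) atTop (𝓝 0) := by
    have h2 : Tendsto (fun N : ℕ => 1 + 1 / (N : ℝ)) atTop (𝓝 (1 + 0)) :=
      tendsto_one_div_atTop_nhds_zero_nat.const_add 1
    have h3 := (hL.comp (tendsto_add_atTop_nat 1)).mul h2
    rw [zero_mul] at h3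
    refine h3.congr' ?_
    filter_upwards [eventually_gt_atTop 0] with N hN
    have : (0 : ℝ) < N := by exact_mod_cast hN
    simp only [Function.comp_apply]
    push_cast
    field_simp
  have h4 := tendsto_theta_div_atTop.comp hcast
  have h5 : Tendsto (fun N : ℕ => (Chebyshev.psi N - Chebyshev.theta N) / (N : ℝ)) atTop (𝓝 0) := by
    have := (tendsto_psi_div_atTop.comp hcast).sub h4
    rw [sub_self] at this
    exact this.congr fun N => by simp only [Function.comp_apply]; ring
  have hnp : Tendsto (fun N : ℕ => (∑ n ∈ Finset.Ioc 0 N with ¬n.Prime,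
      (if n ∈ genBy P then 1 else 0) * ArithmeticFunction.vonMangoldt n) / (N : ℝ))
        atTop (𝓝 0) := by
    refine squeeze_zero (fun N => ?_) (fun N => ?_) h5
    · refine div_nonneg (Finset.sum_nonneg fun n _ =>
        mul_nonneg ?_ ArithmeticFunction.vonMangoldt_nonneg) (by positivity)
      split_ifs <;> simp
    · rw [Chebyshev.psi_sub_theta_eq_sum_not_prime, Nat.floor_natCast]
      gcongr with n hn
      refine mul_le_of_le_one_left ArithmeticFunction.vonMangoldt_nonneg ?_
      split_ifs <;> simp
  have h6 := (h1.add (h4.const_mul z)).add hnp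
  simp only [zero_add, mul_one, add_zero] at h6
  refine h6.congr fun N => ?_
  rw [Function.comp_apply, Chebyshev.theta, Nat.floor_natCast, ← mul_div_assoc, ← add_div,
    ← add_div]
  congr 1
  have hIoc : ∀ f : ℕ → ℝ, f 0 = 0 →
      ∑ k ∈ Finset.range (N + 1), f k = ∑ k ∈ Finset.Ioc 0 N, f k := by
    intro f hf
    rw [Finset.range_eq_Ico, Finset.sum_eq_sum_Ico_succ_bot (by omega), hf, zero_add]
    refine Finset.sum_congr ?_ fun _ _ => rfl
    ext k
    simp only [Finset.mem_Ico, Finset.mem_Ioc]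
    omega
  rw [hIoc _ (by simp), Finset.sum_filter, Finset.sum_filter, Finset.mul_sum,
    ← Finset.sum_add_distrib, ← Finset.sum_add_distrib]
  refine Finset.sum_congr rfl fun n _ => ?_
  by_cases hp : n.Prime
  · by_cases hP : n ∈ P <;>
      simp [hp, hP, prime_mem_genBy hp, ArithmeticFunction.vonMangoldt_apply_prime hp]
    ring
  · simp [hp]

open Classical in
theorem sum_genBy_mul_log (P : Set ℕ) (N : ℕ) :
    ∑ n ∈ Finset.Ioc 0 N, (if n ∈ genBy P then 1 else 0) * log n =
      ∑ m ∈ Finset.Ioc 0 N, (if m ∈ genBy P then 1 else 0) *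
        ∑ d ∈ Finset.Ioc 0 (N / m),
          (if d ∈ genBy P then 1 else 0) * ArithmeticFunction.vonMangoldt d := by
  let f : ArithmeticFunction ℝ := ⟨fun n => if n ∈ genBy P then 1 else 0, by simp [genBy]⟩
  let g : ArithmeticFunction ℝ :=
    ⟨fun n => (if n ∈ genBy P then 1 else 0) * ArithmeticFunction.vonMangoldt n, by simp⟩
  have h := ArithmeticFunction.sum_Ioc_mul_eq_sum_sum f g N
  have hf : ∀ n, f n = if n ∈ genBy P then 1 else 0 := fun _ => rfl
  have hg : ∀ n, g n = (if n ∈ genBy P then 1 else 0) * ArithmeticFunction.vonMangoldt n :=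
    fun _ => rfl
  simp only [hf, hg] at h
  rw [← h]
  refine Finset.sum_congr rfl fun n _ => ?_
  rw [ArithmeticFunction.mul_apply, ← ArithmeticFunction.vonMangoldt_sum, Finset.mul_sum,
    ← Nat.sum_divisorsAntidiagonal' (f := fun _ d =>
      (if n ∈ genBy P then 1 else 0) * ArithmeticFunction.vonMangoldt d)]
  refine Finset.sum_congr rfl fun x hx => ?_
  rw [hf, hg, ← (Nat.mem_divisorsAntidiagonal.1 hx).1]
  by_cases h1 : x.1 ∈ genBy P <;> by_cases h2 : x.2 ∈ genBy P <;> simp [h1, h2, mul_mem_genBy]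

theorem exists_abs_sub_mul_le {f : ℕ → ℝ} {z ε : ℝ} (hε : 0 < ε)
    (hf : Tendsto (fun N : ℕ => f N / (N : ℝ)) atTop (nhds z)) :
    ∃ C, 0 ≤ C ∧ ∀ N : ℕ, |f N - z * N| ≤ ε * N + C := by
  obtain ⟨N₀, hN₀⟩ := Metric.tendsto_atTop.1 hf ε hε
  refine ⟨∑ k ∈ Finset.range (N₀ + 1), |f k - z * k|, Finset.sum_nonneg fun _ _ => abs_nonneg _,
    fun N => ?_⟩
  by_cases hN : N ∈ Finset.range (N₀ + 1)
  · have := Finset.single_le_sum (f := fun k : ℕ => |f k - z * k|) (fun _ _ => abs_nonneg _) hN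
    have h2 : 0 ≤ ε * N := by positivity
    linarith
  · rw [Finset.mem_range] at hN
    have hN' : (0 : ℝ) < N := by exact_mod_cast (by omega : 0 < N)
    have h1 := hN₀ N (by omega)
    have h2 : f N - z * N = (f N / N - z) * N := by field_simp
    have h3 : 0 ≤ ∑ k ∈ Finset.range (N₀ + 1), |f k - z * k| :=
      Finset.sum_nonneg fun _ _ => abs_nonneg _
    rw [Real.dist_eq] at h1
    rw [h2, abs_mul, abs_of_pos hN']
    nlinarith

theorem mul_log_sub_log_factorial_le (N : ℕ) :
    ∑ n ∈ Finset.Ioc 0 N, (log N - log n) ≤ N := by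
  rcases Nat.eq_zero_or_pos N with rfl | hN
  · simp
  have hN' : (0 : ℝ) < N := by exact_mod_cast hN
  have hfac : ∑ n ∈ Finset.Ioc 0 N, log (n : ℝ) = log (N.factorial : ℝ) := by
    clear hN hN'
    induction N with
    | zero => simp
    | succ n ih =>
      rw [Finset.sum_Ioc_succ_top (by omega), ih, Nat.factorial_succ]
      push_cast
      rw [Real.log_mul (by positivity) (by positivity)]
      ring
  have h1 := Real.pow_div_factorial_le_exp (N : ℝ) hN'.le N
  have h2 := Real.log_le_log (by positivity) h1
  rw [Real.log_exp, Real.log_div (by positivity) (by positivity), Real.log_pow] at h2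
  rw [Finset.sum_sub_distrib, hfac]
  simpa using h2

open Classical in
theorem abs_card_genBy_mul_log_sub_le {P : Set ℕ} {z ε C : ℝ} (hz0 : 0 < z) (hz1 : z ≤ 1)
    (hε : 0 < ε) (hC : 0 ≤ C)
    (hf : ∀ N : ℕ, |(∑ n ∈ Finset.Ioc 0 N, (if n ∈ genBy P then 1 else 0) *
      ArithmeticFunction.vonMangoldt n) - z * N| ≤ ε * N + C) (N : ℕ) :
    |(∑ n ∈ Finset.Ioc 0 N, if n ∈ genBy P then (1 : ℝ) else 0) * log N -
        z * (N * ∑ n ∈ Finset.Ioc 0 N, (if n ∈ genBy P then 1 else 0) / (n : ℝ))| ≤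
      ε * (N * ∑ n ∈ Finset.Ioc 0 N, (if n ∈ genBy P then 1 else 0) / (n : ℝ)) + (C + 2) * N := by
  have hi0 : ∀ n, (0 : ℝ) ≤ if n ∈ genBy P then 1 else 0 := fun n => by split_ifs <;> simp
  have hi1 : ∀ n, (if n ∈ genBy P then (1 : ℝ) else 0) ≤ 1 := fun n => by split_ifs <;> simp
  have hA : (∑ n ∈ Finset.Ioc 0 N, if n ∈ genBy P then (1 : ℝ) else 0) * log N =
      ∑ n ∈ Finset.Ioc 0 N, (if n ∈ genBy P then 1 else 0) * log n +
      ∑ n ∈ Finset.Ioc 0 N, (if n ∈ genBy P then 1 else 0) * (log N - log n) := by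
    rw [Finset.sum_mul, ← Finset.sum_add_distrib]
    exact Finset.sum_congr rfl fun n _ => by ring
  have hlog : ∀ n ∈ Finset.Ioc 0 N, 0 ≤ log N - log n := fun n hn => by
    rw [Finset.mem_Ioc] at hn
    have h0 : (0 : ℝ) < n := by exact_mod_cast hn.1
    exact sub_nonneg.2 (Real.log_le_log h0 (by exact_mod_cast hn.2))
  have hB0 : 0 ≤ ∑ n ∈ Finset.Ioc 0 N, (if n ∈ genBy P then 1 else 0) * (log N - log n) :=
    Finset.sum_nonneg fun n hn => mul_nonneg (hi0 n) (hlog n hn)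
  have hB1 : ∑ n ∈ Finset.Ioc 0 N, (if n ∈ genBy P then 1 else 0) * (log N - log n) ≤ N :=
    (Finset.sum_le_sum fun n hn => mul_le_of_le_one_left (hlog n hn) (hi1 n)).trans
      (mul_log_sub_log_factorial_le N)
  have hM : |∑ n ∈ Finset.Ioc 0 N, (if n ∈ genBy P then 1 else 0) * log n -
      z * (N * ∑ n ∈ Finset.Ioc 0 N, (if n ∈ genBy P then 1 else 0) / (n : ℝ))| ≤
      ε * (N * ∑ n ∈ Finset.Ioc 0 N, (if n ∈ genBy P then 1 else 0) / (n : ℝ)) + (C + 1) * N := by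
    have hN : (C + 1) * N = ∑ n ∈ Finset.Ioc 0 N, (C + 1) := by
      rw [Finset.sum_const, Nat.card_Ioc, nsmul_eq_mul, Nat.sub_zero, mul_comm]
    rw [sum_genBy_mul_log, hN]
    simp only [Finset.mul_sum]
    rw [← Finset.sum_sub_distrib, ← Finset.sum_add_distrib]
    refine (Finset.abs_sum_le_sum_abs _ _).trans (Finset.sum_le_sum fun m hm => ?_)
    rw [← Finset.mul_sum]
    by_cases hmP : m ∈ genBy P
    · simp only [hmP, if_true, one_mul]
      have hm0 : (0 : ℝ) < m := by exact_mod_cast (Finset.mem_Ioc.1 hm).1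
      have h1 := abs_le.1 (hf (N / m))
      have h2 : ((N / m : ℕ) : ℝ) ≤ (N : ℝ) / m := Nat.cast_div_le
      have h3 : (N : ℝ) / m - 1 ≤ ((N / m : ℕ) : ℝ) := by
        rw [← Nat.floor_div_eq_div (K := ℝ)]
        exact (Nat.sub_one_lt_floor _).le
      have h4 : (N : ℝ) * (1 / m) = N / m := by ring
      rw [h4, abs_le]
      constructor <;> nlinarith
    · simp only [hmP, if_false]
      simp
      linarith
  rw [hA]
  rw [abs_le] at hM ⊢
  constructor <;> linarith [hM.1, hM.2]

open Classical Topology in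
theorem tendsto_card_genBy_nat {P : Set ℕ} {z : ℝ} (hz0 : 0 < z) (hz1 : z ≤ 1)
    (hD : Tendsto (fun m : ℕ => ∑ k ∈ Finset.range m,
      ((if k ∈ P then 1 else 0) - z) * primeWeight k) atTop (𝓝 0))
    (hL : Tendsto (fun N : ℕ => (∑ k ∈ Finset.range N, ((if k ∈ P then 1 else 0) - z) *
      if k.Prime then log k else 0) / (N : ℝ)) atTop (𝓝 0)) :
    Tendsto (fun N : ℕ => (∑ n ∈ Finset.Ioc 0 N, if n ∈ genBy P then (1 : ℝ) else 0) *
      log N ^ (1 - z) / N) atTop (𝓝 (Gamma z)⁻¹) := by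
  have hG := Real.Gamma_pos_of_pos (by linarith : 0 < z + 1)
  have hGz := Real.Gamma_add_one hz0.ne'
  set L : ℕ → ℝ := fun N => ∑ n ∈ Finset.Ioc 0 N, (if n ∈ genBy P then 1 else 0) / (n : ℝ) with hLd
  have h1 : Tendsto (fun N : ℕ => L N / log N ^ z) atTop (𝓝 (Gamma (z + 1))⁻¹) := by
    refine ((tendsto_sum_genBy_div hz0 hz1 hD).comp tendsto_natCast_atTop_atTop).congr fun N => ?_
    simp only [Function.comp_apply, Nat.floor_natCast, hLd]
    congr 1
    rw [Finset.range_eq_Ico, Finset.sum_eq_sum_Ico_succ_bot (by omega)]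
    simp only [Nat.cast_zero, div_zero, zero_add]
    refine Finset.sum_congr ?_ fun _ _ => rfl
    ext k
    simp only [Finset.mem_Ico, Finset.mem_Ioc]
    omega
  have hlog : Tendsto (fun N : ℕ => log (N : ℝ)) atTop atTop :=
    tendsto_log_atTop.comp tendsto_natCast_atTop_atTop
  have hlogz : Tendsto (fun N : ℕ => log (N : ℝ) ^ z) atTop atTop :=
    (tendsto_rpow_atTop hz0).comp hlog
  have h2 : Tendsto (fun N : ℕ => (∑ n ∈ Finset.Ioc 0 N, if n ∈ genBy P then (1 : ℝ) else 0) *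
      log N ^ (1 - z) / N - z * (L N / log N ^ z)) atTop (𝓝 0) := by
    rw [Metric.tendsto_atTop']
    intro η hη
    set K := (Gamma (z + 1))⁻¹ + 1 with hK
    have hK0 : 0 < K := by positivity
    obtain ⟨C, hC, hf⟩ := exists_abs_sub_mul_le (ε := η / (2 * K)) (by positivity)
      (tendsto_sum_vonMangoldt_genBy_div hL)
    have e1 := h1.eventually (gt_mem_nhds (by linarith : (Gamma (z + 1))⁻¹ < K))
    have e2 := hlogz.eventually (eventually_gt_atTop (2 * (C + 2) / η))
    have e3 := hlog.eventually (eventually_gt_atTop 0)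
    obtain ⟨N₀, hN₀⟩ := eventually_atTop.1 (e1.and (e2.and (e3.and (eventually_gt_atTop 0))))
    refine ⟨N₀, fun N hN => ?_⟩
    obtain ⟨k1, k2, k3, k4⟩ := hN₀ N hN.le
    have hN0 : (0 : ℝ) < N := by exact_mod_cast k4
    have hb := abs_card_genBy_mul_log_sub_le hz0 hz1 (by positivity) hC hf N
    have hp : 0 < log (N : ℝ) ^ z := Real.rpow_pos_of_pos k3 z
    rw [Real.dist_eq, sub_zero]
    have e : (∑ n ∈ Finset.Ioc 0 N, if n ∈ genBy P then (1 : ℝ) else 0) *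
        log N ^ (1 - z) / N - z * (L N / log N ^ z) =
        ((∑ n ∈ Finset.Ioc 0 N, if n ∈ genBy P then (1 : ℝ) else 0) * log N - z * (N * L N)) /
          (N * log N ^ z) := by
      rw [Real.rpow_sub k3, Real.rpow_one]
      field_simp
    rw [e, abs_div, abs_of_pos (mul_pos hN0 hp), div_lt_iff₀ (mul_pos hN0 hp)]
    refine hb.trans_lt ?_
    rw [div_lt_iff₀ hp] at k1
    rw [div_lt_iff₀ hη] at k2
    have k5 : η / (2 * K) * (N * L N) < η / (2 * K) * (N * (K * log N ^ z)) := by gcongr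
    have k6 : η / (2 * K) * (N * (K * log N ^ z)) = η / 2 * (N * log N ^ z) := by field_simp
    change η / (2 * K) * (N * L N) + (C + 2) * N < _
    nlinarith
  have h3 := h2.add (h1.const_mul z)
  have h4 : 0 + z * (Gamma (z + 1))⁻¹ = (Gamma z)⁻¹ := by
    rw [hGz, zero_add, mul_inv, ← mul_assoc, mul_inv_cancel₀ hz0.ne', one_mul]
  rw [h4] at h3
  exact h3.congr fun N => by ring

open Classical Topology in
theorem tendsto_mul_log_rpow_div_of_nat {S : ℕ → ℝ} {a b : ℝ}
    (hS : Tendsto (fun N : ℕ => S N * log N ^ a / N) atTop (𝓝 b)) :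
    Tendsto (fun x : ℝ => S ⌊x⌋₊ * log x ^ a / x) atTop (𝓝 b) := by
  have h1 := hS.comp (tendsto_nat_floor_atTop (α := ℝ))
  have h2 : Tendsto (fun x : ℝ => (⌊x⌋₊ : ℝ) / x) atTop (𝓝 1) := tendsto_nat_floor_div_atTop
  have h3 : Tendsto (fun x : ℝ => log x / log ⌊x⌋₊) atTop (𝓝 1) := by
    have h4 : Tendsto (fun x : ℝ => log ((⌊x⌋₊ : ℝ) / x) / log x) atTop (𝓝 0) :=
      ((Real.continuousAt_log one_ne_zero).tendsto.comp h2).div_atTop tendsto_log_atTop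
    have h5 := (h4.const_add 1).inv₀ (by norm_num)
    rw [add_zero, inv_one] at h5
    refine h5.congr' ?_
    filter_upwards [eventually_gt_atTop 1] with x hx
    have hl : 0 < log x := Real.log_pos hx
    have hf : 0 < (⌊x⌋₊ : ℝ) := by exact_mod_cast Nat.floor_pos.2 hx.le
    rw [Real.log_div hf.ne' (by linarith), sub_div, div_self hl.ne', add_sub_cancel, inv_div]
  have h6 := (h1.mul h2).mul (h3.rpow_const (p := a) (Or.inl one_ne_zero))
  rw [mul_one, Real.one_rpow, mul_one] at h6
  refine h6.congr' ?_
  filter_upwards [eventually_ge_atTop 2] with x hx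
  have hf2 : 2 ≤ ⌊x⌋₊ := Nat.le_floor (by exact_mod_cast hx)
  have hf : (2 : ℝ) ≤ (⌊x⌋₊ : ℝ) := by exact_mod_cast hf2
  have hl : 0 < log (⌊x⌋₊ : ℝ) := Real.log_pos (by linarith)
  have hl' : 0 < log x := Real.log_pos (by linarith)
  have hp := Real.rpow_pos_of_pos hl a
  simp only [Function.comp_apply]
  rw [Real.div_rpow hl'.le hl.le]
  field_simp

theorem isMC_genBy {h : ℕ} (c : ℕ → Fin h) : IsMC h fun i => genBy {k | c k = i} := by
  have hex : ∀ n : ℕ, 1 ≤ n →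
      ∃ f : Fin h → ℕ, (∀ i, f i ∈ genBy {k | c k = i}) ∧ ∏ i, f i = n := by
    intro n
    induction n using induction_on_primes with
    | zero => simp
    | one => exact fun _ => ⟨fun _ => 1, fun _ => one_mem_genBy _, by simp⟩
    | prime_mul p a hp ih =>
      intro hpa
      obtain ⟨f, hf, rfl⟩ := ih (Nat.pos_of_mul_pos_left hpa)
      refine ⟨fun i => (if c p = i then p else 1) * f i, fun i => mul_mem_genBy.2 ⟨?_, hf i⟩, ?_⟩
      · split_ifs with hi
        · exact (prime_mem_genBy hp).2 hi
        · exact one_mem_genBy _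
      · rw [Finset.prod_mul_distrib]
        simp
  intro n hn
  obtain ⟨f, hf⟩ := hex n hn
  refine (Set.ncard_pos ?_).2 ⟨f, hf⟩
  refine (Set.finite_Iic fun _ : Fin h => n).subset fun g hg i => ?_
  exact Nat.le_of_dvd hn (hg.2 ▸ Finset.dvd_prod_of_mem g (Finset.mem_univ i))

open Classical in
theorem cntF_eq_sum (A : Set ℕ) (x : ℝ) :
    (cntF A x : ℝ) = ∑ n ∈ Finset.Ioc 0 ⌊x⌋₊, if n ∈ A then (1 : ℝ) else 0 := by
  have h : A ∩ Set.Icc 1 ⌊x⌋₊ = ((Finset.Ioc 0 ⌊x⌋₊).filter (· ∈ A) : Finset ℕ) := by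
    ext n
    simp [Nat.succ_le_iff]
    tauto
  rw [cntF, h, Set.ncard_coe_finset, Finset.sum_boole]

open Topology in
theorem tendsto_finset_sup_mul {ι α : Type*} [Fintype ι] [Nonempty ι] {l : Filter α}
    {u : ι → α → ℕ} {v : α → ℝ} {b : ℝ}
    (hu : ∀ i, Tendsto (fun x => (u i x : ℝ) * v x) l (𝓝 b)) :
    Tendsto (fun x => ((Finset.univ.sup fun i => u i x : ℕ) : ℝ) * v x) l (𝓝 b) := by
  rw [tendsto_def]
  intro s hs
  filter_upwards [eventually_all.2 fun i => (hu i).eventually hs] with x hx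
  obtain ⟨i, -, hi⟩ := Finset.exists_mem_eq_sup Finset.univ Finset.univ_nonempty fun i => u i x
  simp only [Set.mem_preimage, hi]
  exact hx i

open Topology in
theorem tendsto_zero_of_mul_log {D : ℕ → ℝ}
    (hD : Tendsto (fun m : ℕ => D m * log m) atTop (𝓝 0)) : Tendsto D atTop (𝓝 0) := by
  have hlog : Tendsto (fun N : ℕ => log (N : ℝ)) atTop atTop :=
    tendsto_log_atTop.comp tendsto_natCast_atTop_atTop
  refine (hD.div_atTop hlog).congr' ?_
  filter_upwards [hlog.eventually (eventually_gt_atTop 0)] with m hm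
  field_simp

theorem stmt6 (h : ℕ) (hh : 1 ≤ h) :
    ∃ A : Fin h → Set ℕ, (∀ i, 0 ∉ A i) ∧ IsMC h A ∧
      Filter.Tendsto (fun x : ℝ =>
          ((Finset.univ.sup fun i => cntF (A i) x : ℕ) : ℝ) *
            Real.log x ^ (1 - 1 / (h : ℝ)) / x)
        Filter.atTop (nhds ((Real.Gamma (1 / h))⁻¹)) := by
  classical
  obtain ⟨c, hc⟩ := exists_balanced_assignment hh
  have hh' : (1 : ℝ) ≤ h := by exact_mod_cast hh
  have hz0 : 0 < 1 / (h : ℝ) := by positivity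
  have hz1 : 1 / (h : ℝ) ≤ 1 := by
    rw [div_le_one (by linarith)]
    exact hh'
  have : Nonempty (Fin h) := ⟨⟨0, hh⟩⟩
  refine ⟨fun i => genBy {k | c k = i}, fun i hi => hi.1 rfl, isMC_genBy c, ?_⟩
  simp_rw [mul_div_assoc]
  refine tendsto_finset_sup_mul fun i => ?_
  have hL := tendsto_sum_mul_log_div (δ := fun k => (if c k = i then 1 else 0) - 1 / (h : ℝ))
    (fun k => abs_le.2 (by split_ifs <;> constructor <;> linarith)) (hc i)
  have hD := tendsto_zero_of_mul_log (hc i)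
  have key := tendsto_mul_log_rpow_div_of_nat
    (tendsto_card_genBy_nat (P := {k | c k = i}) hz0 hz1
      (hD.congr fun m => Finset.sum_congr rfl fun k _ => by congr)
      (hL.congr fun m => by congr!))
  refine key.congr fun x => ?_
  rw [cntF_eq_sum, mul_div_assoc]
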